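/- Let G be a finitely generated nilpotent group given by a finite presentation whose Dehn function satisfies δ(n) = O(n^k) for some real number k > 2. Then the averaged Dehn function of that presentation satisfies δ^avg(n) = O(n^{k/2}). -/

import Mathlib

/-!
Statement 0: If `G` is a finitely generated nilpotent group given by a finite presentation
whose Dehn function satisfies `δ(n) = O(n^k)` for a real `k > 2`, then the averaged Dehn
function of that presentation satisfies `δ^avg(n) = O(n^(k/2))`.
-/

namespace AvgDehnPaper

variable {d s : ℕ}

/-- The normal closure of the relators: `R ⊆ F`. -/
def relSubgroup (r : Fin s → FreeGroup (Fin d)) : Subgroup (FreeGroup (Fin d)) :=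
  Subgroup.normalClosure (Set.range r)

instance (r : Fin s → FreeGroup (Fin d)) : (relSubgroup r).Normal :=
  Subgroup.normalClosure_normal

/-- The filling area `δ(w)` of a word `w` representing the identity: the least `k` such
that `w` is a product of `k` conjugates of relators (or their inverses) in `F`. -/
noncomputable def fillingArea (r : Fin s → FreeGroup (Fin d)) (w : FreeGroup (Fin d)) : ℕ :=
  sInf { k | ∃ (g : Fin k → FreeGroup (Fin d)) (a : Fin k → Fin s) (ε : Fin k → Bool),
    w = (List.ofFn (fun i => (g i)⁻¹ * (r (a i)) ^ (if ε i then (1 : ℤ) else -1) * g i)).prod }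

/-- The Dehn function `δ(n)`: the maximal filling area over words of length at most `n`
representing the identity. -/
noncomputable def dehn (r : Fin s → FreeGroup (Fin d)) (n : ℕ) : ℕ :=
  sSup { A | ∃ w ∈ relSubgroup r, FreeGroup.norm w ≤ n ∧ A = fillingArea r w }

/-- A lazy letter: either the identity (`none`) or a generator or its inverse. -/
abbrev Letter (d : ℕ) := Option (Fin d × Bool)

/-- The value of a lazy letter in the free group. -/
def letterVal : Letter d → FreeGroup (Fin d)
  | none => 1
  | some (i, b) => if b then FreeGroup.of i else (FreeGroup.of i)⁻¹

/-- The element of the free group spelled by the first `t` letters of a lazy word. -/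
def partialProd {n : ℕ} (w : Fin n → Letter d) (t : ℕ) : FreeGroup (Fin d) :=
  (((List.ofFn w).take t).map letterVal).prod

open scoped Classical in
/-- The (finite, nonempty) set of lazy words of length `n` representing the identity in `G`. -/
noncomputable def closedWords (r : Fin s → FreeGroup (Fin d)) (n : ℕ) :
    Finset (Fin n → Letter d) :=
  Finset.univ.filter (fun w => partialProd w n ∈ relSubgroup r)

/-- The averaged Dehn function: the average of `δ(w)` over all lazy words of length `n`
representing the identity, with respect to the uniform measure. -/
noncomputable def avgDehn (r : Fin s → FreeGroup (Fin d)) (n : ℕ) : ℝ :=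
  (∑ w ∈ closedWords r n, (fillingArea r (partialProd w n) : ℝ)) /
    ((closedWords r n).card : ℝ)

section Auxiliary

open scoped Pointwise commutatorElement

section Growth
variable {G : Type*} [Group G]

/-- The lower central series of a group, starting with `lcs 0 = ⊤`. -/
abbrev lcs (G : Type*) [Group G] (n : ℕ) : Subgroup G := (⊤ : Subgroup G).lowerCentralSeries n

lemma lcs_antitone : Antitone (lcs G) := Subgroup.lowerCentralSeries_antitone _

lemma commutator_mem_lcs_succ {n : ℕ} {x : G} (hx : x ∈ lcs G n) (y : G) :
    ⁅x, y⁆ ∈ lcs G (n + 1) :=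
  Subgroup.commutator_mem_commutator hx (Subgroup.mem_top y)

lemma three_subgroups_le (A B C N : Subgroup G) [N.Normal] (h1 : ⁅⁅B, C⁆, A⁆ ≤ N)
    (h2 : ⁅⁅C, A⁆, B⁆ ≤ N) : ⁅⁅A, B⁆, C⁆ ≤ N := by
  have key : ∀ H : Subgroup G, H ≤ N ↔ H.map (QuotientGroup.mk' N) = ⊥ := fun H => by
    rw [Subgroup.map_eq_bot_iff, QuotientGroup.ker_mk']
  rw [key, Subgroup.map_commutator, Subgroup.map_commutator] at *
  exact Subgroup.commutator_commutator_eq_bot_of_rotate h1 h2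

lemma commutator_lcs_le (i j : ℕ) : ⁅lcs G i, lcs G j⁆ ≤ lcs G (i + j + 1) := by
  induction j generalizing i with
  | zero => exact le_refl _
  | succ j ih =>
    rw [Subgroup.commutator_comm]
    change ⁅⁅lcs G j, ⊤⁆, lcs G i⁆ ≤ _
    apply three_subgroups_le
    · rw [Subgroup.commutator_comm ⊤]
      have := ih (i + 1)
      rw [show i + 1 + j + 1 = i + (j + 1) + 1 by ring] at this
      exact this
    · have := Subgroup.commutator_mono (ih i) (le_refl (⊤ : Subgroup G))
      exact this

lemma commutator_mem_lcs {i j : ℕ} {x y : G} (hx : x ∈ lcs G i) (hy : y ∈ lcs G j) :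
    ⁅x, y⁆ ∈ lcs G (i + j + 1) :=
  commutator_lcs_le i j (Subgroup.commutator_mem_commutator hx hy)

lemma lcs_quotient_eq_bot (n : ℕ) : lcs (G ⧸ lcs G n) n = ⊥ := by
  have := Subgroup.map_lowerCentralSeries (⊤ : Subgroup G) (QuotientGroup.mk' (lcs G n)) n
  rw [Subgroup.map_top_of_surjective _ (QuotientGroup.mk'_surjective _)] at this
  change (⊤ : Subgroup (G ⧸ lcs G n)).lowerCentralSeries n = ⊥
  rw [← this, Subgroup.map_eq_bot_iff, QuotientGroup.ker_mk']

lemma central_of_lcs_succ_eq_bot {n : ℕ} (h : lcs G (n + 1) = ⊥) {x : G} (hx : x ∈ lcs G n)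
    (y : G) : Commute x y := by
  have := commutator_mem_lcs_succ hx y
  rw [h, Subgroup.mem_bot] at this
  exact commutatorElement_eq_one_iff_commute.1 this

/-- `WCost A ρ g x` says that `g` is spelled by a word in the letters `p.1^{±1}`, `p ∈ A`, of total
cost `x`, where the letter `p` of weight `p.2` costs `ρ ^ p.2`. -/
inductive WCost (A : Set (G × ℕ)) (ρ : ℝ) : G → ℝ → Prop
  | one : WCost A ρ 1 0
  | mul {p : G × ℕ} {g : G} {x : ℝ} : p ∈ A → WCost A ρ g x → WCost A ρ (p.1 * g) (x + ρ ^ p.2)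
  | inv {p : G × ℕ} {g : G} {x : ℝ} : p ∈ A → WCost A ρ g x → WCost A ρ (p.1⁻¹ * g) (x + ρ ^ p.2)

/-- `g` is spelled by a word of cost at most `x`. -/
def WLe (A : Set (G × ℕ)) (ρ : ℝ) (g : G) (x : ℝ) : Prop := ∃ y ≤ x, WCost A ρ g y

variable {A B : Set (G × ℕ)} {ρ : ℝ} {g h : G} {x y : ℝ}

lemma WCost.nonneg (hρ : 0 ≤ ρ) (H : WCost A ρ g x) : 0 ≤ x := by
  induction H with
  | one => exact le_refl _
  | mul _ _ ih => positivity
  | inv _ _ ih => positivity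

lemma WCost.append (H : WCost A ρ g x) (H' : WCost A ρ h y) : WCost A ρ (g * h) (x + y) := by
  induction H with
  | one => simpa using H'
  | @mul p g x hp _ ih =>
    have := WCost.mul hp ih
    rwa [← mul_assoc, show x + y + ρ ^ p.2 = x + ρ ^ p.2 + y by ring] at this
  | @inv p g x hp _ ih =>
    have := WCost.inv hp ih
    rwa [← mul_assoc, show x + y + ρ ^ p.2 = x + ρ ^ p.2 + y by ring] at this

lemma WCost.inverse (H : WCost A ρ g x) : WCost A ρ g⁻¹ x := by
  induction H with
  | one => simpa using WCost.one
  | @mul p g x hp _ ih =>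
    have := ih.append (WCost.inv hp WCost.one)
    simpa using this
  | @inv p g x hp _ ih =>
    have := ih.append (WCost.mul hp WCost.one)
    simpa using this

lemma WLe.mono (H : WLe A ρ g x) (hxy : x ≤ y) : WLe A ρ g y := by
  obtain ⟨z, hz, H⟩ := H
  exact ⟨z, hz.trans hxy, H⟩

lemma WCost.mono_set (H : WCost A ρ g x) (hAB : A ⊆ B) : WCost B ρ g x := by
  induction H with
  | one => exact WCost.one
  | mul hp _ ih => exact WCost.mul (hAB hp) ih
  | inv hp _ ih => exact WCost.inv (hAB hp) ih

lemma WLe.mono_set (H : WLe A ρ g x) (hAB : A ⊆ B) : WLe B ρ g x := by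
  obtain ⟨z, hz, H⟩ := H
  exact ⟨z, hz, H.mono_set hAB⟩

lemma WLe.mul (H : WLe A ρ g x) (H' : WLe A ρ h y) : WLe A ρ (g * h) (x + y) := by
  obtain ⟨z, hz, H⟩ := H
  obtain ⟨z', hz', H'⟩ := H'
  exact ⟨z + z', by linarith, H.append H'⟩

lemma WLe.inv (H : WLe A ρ g x) : WLe A ρ g⁻¹ x := by
  obtain ⟨z, hz, H⟩ := H
  exact ⟨z, hz, H.inverse⟩

lemma WLe.one (hx : 0 ≤ x) : WLe A ρ 1 x := ⟨0, hx, WCost.one⟩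

lemma WLe.pow (H : WLe A ρ g x) (n : ℕ) : WLe A ρ (g ^ n) (n * x) := by
  induction n with
  | zero => simpa using WLe.one (le_refl _)
  | succ n ih =>
    rw [pow_succ]
    refine (ih.mul H).mono (le_of_eq ?_)
    push_cast; ring

lemma WLe.zpow (H : WLe A ρ g x) (n : ℤ) : WLe A ρ (g ^ n) (|(n : ℝ)| * x) := by
  have h := H.pow n.natAbs
  have e : ((n.natAbs : ℕ) : ℝ) = |(n : ℝ)| := by
    rw [← Int.cast_natCast, Int.natCast_natAbs, Int.cast_abs]
  rw [e] at h
  rcases Int.natAbs_eq n with h' | h'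
  · rw [h', zpow_natCast, ← h']; exact h
  · rw [h', zpow_neg, zpow_natCast, ← h']; exact h.inv

lemma WLe.of_mem {p : G × ℕ} (hp : p ∈ A) : WLe A ρ p.1 (ρ ^ p.2) :=
  ⟨_, le_refl _, by simpa using WCost.mul hp (WCost.one (A := A) (ρ := ρ))⟩

lemma WCost.mem_closure (H : WCost A ρ g x) : g ∈ Subgroup.closure (Prod.fst '' A) := by
  induction H with
  | one => exact one_mem _
  | mul hp _ ih => exact mul_mem (Subgroup.subset_closure ⟨_, hp, rfl⟩) ih
  | inv hp _ ih => exact mul_mem (inv_mem (Subgroup.subset_closure ⟨_, hp, rfl⟩)) ih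

lemma WLe.mem_closure (H : WLe A ρ g x) : g ∈ Subgroup.closure (Prod.fst '' A) :=
  H.choose_spec.2.mem_closure

/-- Elements generated by letters of weight at least `v` cost `O(ρ ^ v)`. -/
lemma exists_WLe_of_mem_closure {v : ℕ}
    (hg : g ∈ Subgroup.closure (Prod.fst '' {p ∈ A | v ≤ p.2})) :
    ∃ D : ℝ, 0 ≤ D ∧ ∀ ρ : ℝ, 0 < ρ → ρ ≤ 1 → WLe A ρ g (D * ρ ^ v) := by
  induction hg using Subgroup.closure_induction with
  | mem x hx =>
    obtain ⟨p, ⟨hp, hv⟩, rfl⟩ := hx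
    refine ⟨1, zero_le_one, fun ρ h0 h1 => (WLe.of_mem hp).mono ?_⟩
    rw [one_mul]
    exact pow_le_pow_of_le_one h0.le h1 hv
  | one => exact ⟨0, le_refl _, fun ρ h0 h1 => WLe.one (by simp)⟩
  | mul x y _ _ hx hy =>
    obtain ⟨D, hD, hx⟩ := hx
    obtain ⟨E, hE, hy⟩ := hy
    refine ⟨D + E, by positivity, fun ρ h0 h1 => ?_⟩
    rw [add_mul]
    exact (hx ρ h0 h1).mul (hy ρ h0 h1)
  | inv x _ hx =>
    obtain ⟨D, hD, hx⟩ := hx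
    exact ⟨D, hD, fun ρ h0 h1 => (hx ρ h0 h1).inv⟩

/-- Conjugating an element of weight `v` by the `a`-th power of an element of weight `w` multiplies
its cost at most by a constant times `(1 + ρ ^ w) ^ a`. -/
lemma exists_WLe_conj {A : Set (G × ℕ)} {c w v : ℕ} {t y : G} (hc : lcs G c = ⊥) (hw : 1 ≤ w)
    (ht : t ∈ lcs G (w - 1))
    (hgen : ∀ u, w < u → lcs G (u - 1) ≤ Subgroup.closure (Prod.fst '' {p ∈ A | u ≤ p.2}))
    (hv : 1 ≤ v) (hy : y ∈ lcs G (v - 1))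
    (hy' : ∃ D : ℝ, 0 ≤ D ∧ ∀ ρ : ℝ, 0 < ρ → ρ ≤ 1 → WLe A ρ y (D * ρ ^ v)) :
    ∃ D : ℝ, 0 ≤ D ∧ ∀ ρ : ℝ, 0 < ρ → ρ ≤ 1 → ∀ a : ℕ,
      WLe A ρ (t ^ a * y * (t ^ a)⁻¹) (D * ρ ^ v * (1 + ρ ^ w) ^ a) := by
  set s : ℕ → G := fun k => (fun x => ⁅x⁻¹, t⁆)^[k] y with hs
  have s0 : s 0 = y := rfl
  have s1 : ∀ k, s (k + 1) = ⁅(s k)⁻¹, t⁆ := fun k => by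
    simp only [hs, Function.iterate_succ_apply']
  have hmem : ∀ k, s k ∈ lcs G (v - 1 + k * w) := by
    intro k
    induction k with
    | zero => simpa [s0] using hy
    | succ k ih =>
      rw [s1]
      have := commutator_mem_lcs (inv_mem ih) ht
      rwa [show v - 1 + k * w + (w - 1) + 1 = v - 1 + (k + 1) * w by
        rw [add_one_mul]; omega] at this
  have hk : ∀ k, ∃ D : ℝ, 0 ≤ D ∧ ∀ ρ : ℝ, 0 < ρ → ρ ≤ 1 → WLe A ρ (s k) (D * ρ ^ (v + k * w)) := by
    intro k
    rcases Nat.eq_zero_or_pos k with rfl | hk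
    · simpa [s0] using hy'
    · have hkw : w ≤ k * w := Nat.le_mul_of_pos_left w hk
      apply exists_WLe_of_mem_closure
      apply hgen _ (by omega)
      rw [show v + k * w - 1 = v - 1 + k * w by omega]
      exact hmem k
  choose D hD0 hD using hk
  set E : ℝ := ∑ k ∈ Finset.range c, D k with hE
  have hE0 : 0 ≤ E := Finset.sum_nonneg fun k _ => hD0 k
  have hEk : ∀ k, ∀ ρ : ℝ, 0 < ρ → ρ ≤ 1 → WLe A ρ (s k) (E * ρ ^ (v + k * w)) := by
    intro k ρ h0 h1
    by_cases hkc : k < c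
    · refine (hD k ρ h0 h1).mono (mul_le_mul_of_nonneg_right ?_ (by positivity))
      exact Finset.single_le_sum (fun i _ => hD0 i) (Finset.mem_range.2 hkc)
    · have h := lcs_antitone (show c ≤ v - 1 + k * w by
        have : k ≤ k * w := Nat.le_mul_of_pos_right k hw
        omega) (hmem k)
      rw [hc, Subgroup.mem_bot] at h
      rw [h]
      exact WLe.one (by positivity)
  have key : ∀ ρ : ℝ, 0 < ρ → ρ ≤ 1 → ∀ a k : ℕ,
      WLe A ρ (t ^ a * s k * (t ^ a)⁻¹) (E * ρ ^ (v + k * w) * (1 + ρ ^ w) ^ a) := by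
    intro ρ h0 h1 a
    induction a with
    | zero => intro k; simpa using hEk k ρ h0 h1
    | succ a ih =>
      intro k
      have h := (ih k).mul (ih (k + 1))
      convert h using 1
      · rw [s1, commutatorElement_def, pow_succ]
        group
      · rw [pow_succ, add_one_mul k w, ← add_assoc v, pow_add ρ (v + k * w)]
        ring
  exact ⟨E, hE0, fun ρ h0 h1 a => by simpa [s0] using key ρ h0 h1 a 0⟩

/-- Collecting all occurrences of a letter `t` of lowest weight to the left. -/
lemma exists_collect {A : Set (G × ℕ)} {c w : ℕ} {t : G} (hfin : A.Finite) (hc : lcs G c = ⊥)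
    (hw : 1 ≤ w) (ht : t ∈ lcs G (w - 1)) (hA : ∀ p ∈ A, 1 ≤ p.2 ∧ p.1 ∈ lcs G (p.2 - 1))
    (hgen : ∀ u, w < u → lcs G (u - 1) ≤ Subgroup.closure (Prod.fst '' {p ∈ A | u ≤ p.2}))
    (X : ℝ) :
    ∃ K : ℝ, 0 ≤ K ∧ ∀ ρ : ℝ, 0 < ρ → ρ ≤ 1 → ∀ g : G, ∀ x ≤ X, WCost (insert (t, w) A) ρ g x →
      ∃ (a : ℤ) (h : G), g = t ^ a * h ∧ |(a : ℝ)| * ρ ^ w ≤ x ∧ WLe A ρ h (K * x) := by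
  have conj : ∀ p : G × ℕ, ∃ D : ℝ, 0 ≤ D ∧ (p ∈ A → ∀ ρ : ℝ, 0 < ρ → ρ ≤ 1 → ∀ a : ℤ,
      |(a : ℝ)| * ρ ^ w ≤ X → WLe A ρ (t ^ (-a) * p.1 * t ^ a) (D * ρ ^ p.2)) := by
    intro p
    by_cases hp : p ∈ A
    swap
    · exact ⟨0, le_refl _, fun h => absurd h hp⟩
    have base : ∃ D : ℝ, 0 ≤ D ∧ ∀ ρ : ℝ, 0 < ρ → ρ ≤ 1 → WLe A ρ p.1 (D * ρ ^ p.2) :=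
      ⟨1, zero_le_one, fun ρ _ _ => by simpa using WLe.of_mem hp⟩
    obtain ⟨D₁, hD₁, h₁⟩ := exists_WLe_conj hc hw ht hgen (hA p hp).1 (hA p hp).2 base
    obtain ⟨D₂, hD₂, h₂⟩ := exists_WLe_conj hc hw (inv_mem ht) hgen (hA p hp).1 (hA p hp).2 base
    have bound : ∀ ρ : ℝ, 0 < ρ → ∀ n : ℕ, (n : ℝ) * ρ ^ w ≤ X → (1 + ρ ^ w) ^ n ≤ Real.exp X := by
      intro ρ h0 n hn
      calc (1 + ρ ^ w) ^ n ≤ (Real.exp (ρ ^ w)) ^ n := by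
            gcongr
            rw [add_comm]; exact Real.add_one_le_exp _
        _ = Real.exp (n * ρ ^ w) := by rw [← Real.exp_nat_mul]
        _ ≤ Real.exp X := Real.exp_le_exp.2 hn
    refine ⟨(D₁ + D₂) * Real.exp X, by positivity, fun _ ρ h0 h1 a ha => ?_⟩
    obtain ⟨n, rfl | rfl⟩ := Int.eq_nat_or_neg a
    · have hn : (n : ℝ) * ρ ^ w ≤ X := by simpa using ha
      have := h₂ ρ h0 h1 n
      rw [inv_pow, inv_inv] at this
      rw [zpow_neg, zpow_natCast]
      refine this.mono ?_
      calc D₂ * ρ ^ p.2 * (1 + ρ ^ w) ^ n ≤ (D₁ + D₂) * ρ ^ p.2 * Real.exp X := by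
            gcongr
            · linarith
            · exact bound ρ h0 n hn
        _ = _ := by ring
    · have hn : (n : ℝ) * ρ ^ w ≤ X := by simpa using ha
      have := h₁ ρ h0 h1 n
      rw [neg_neg, zpow_neg, zpow_natCast]
      refine this.mono ?_
      calc D₁ * ρ ^ p.2 * (1 + ρ ^ w) ^ n ≤ (D₁ + D₂) * ρ ^ p.2 * Real.exp X := by
            gcongr
            · linarith
            · exact bound ρ h0 n hn
        _ = _ := by ring
  choose D hD0 hD using conj
  set K : ℝ := ∑ p ∈ hfin.toFinset, D p with hK
  have hK0 : 0 ≤ K := Finset.sum_nonneg fun p _ => hD0 p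
  have hDK : ∀ p ∈ A, D p ≤ K := fun p hp =>
    Finset.single_le_sum (fun i _ => hD0 i) (hfin.mem_toFinset.2 hp)
  refine ⟨K, hK0, fun ρ h0 h1 g x hx H => ?_⟩
  induction H with
  | one => exact ⟨0, 1, by simp, by simp, WLe.one (by simp)⟩
  | @mul p g x hp H ih =>
    have hρ : 0 < ρ ^ p.2 := pow_pos h0 _
    obtain ⟨a, h, rfl, ha, hh⟩ := ih (by linarith)
    rcases hp with rfl | hp
    · refine ⟨a + 1, h, by rw [zpow_add, zpow_one, ← mul_assoc, ← zpow_one_add, add_comm, zpow_add,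
        zpow_one], ?_, hh.mono ?_⟩
      · have : |((a + 1 : ℤ) : ℝ)| ≤ |(a : ℝ)| + 1 := by
          push_cast
          exact (abs_add_le _ _).trans (by simp)
        calc _ ≤ (|(a : ℝ)| + 1) * ρ ^ w := by gcongr
          _ ≤ _ := by rw [add_mul, one_mul]; linarith
      · exact mul_le_mul_of_nonneg_left (by linarith) hK0
    · refine ⟨a, t ^ (-a) * p.1 * t ^ a * h, by group, by linarith, ?_⟩
      have := (hD p hp ρ h0 h1 a (by linarith)).mul hh
      refine this.mono ?_
      have := mul_le_mul_of_nonneg_right (hDK p hp) hρ.le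
      linarith
  | @inv p g x hp H ih =>
    have hρ : 0 < ρ ^ p.2 := pow_pos h0 _
    obtain ⟨a, h, rfl, ha, hh⟩ := ih (by linarith)
    rcases hp with rfl | hp
    · refine ⟨a - 1, h, by group, ?_, hh.mono ?_⟩
      · have : |((a - 1 : ℤ) : ℝ)| ≤ |(a : ℝ)| + 1 := by
          push_cast
          exact (abs_sub _ _).trans (by simp)
        calc _ ≤ (|(a : ℝ)| + 1) * ρ ^ w := by gcongr
          _ ≤ _ := by rw [add_mul, one_mul]; linarith
      · exact mul_le_mul_of_nonneg_left (by linarith) hK0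
    · refine ⟨a, t ^ (-a) * p.1⁻¹ * t ^ a * h, by group, by linarith, ?_⟩
      have := (hD p hp ρ h0 h1 a (by linarith)).inv.mul hh
      have e : (t ^ (-a) * p.1 * t ^ a)⁻¹ = t ^ (-a) * p.1⁻¹ * t ^ a := by group
      rw [e] at this
      refine this.mono ?_
      have := mul_le_mul_of_nonneg_right (hDK p hp) hρ.le
      linarith

/-- A letter of lowest weight can be eliminated from words representing elements of the subgroup
generated by the other letters, at the price of a constant. -/
lemma exists_WLe_eliminate {A : Set (G × ℕ)} {c w : ℕ} {t : G} (hfin : A.Finite)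
    (hc : lcs G c = ⊥) (hw : 1 ≤ w) (ht : t ∈ lcs G (w - 1))
    (hA : ∀ p ∈ A, w ≤ p.2 ∧ p.1 ∈ lcs G (p.2 - 1))
    (hgen : ∀ u, w < u → lcs G (u - 1) ≤ Subgroup.closure (Prod.fst '' {p ∈ A | u ≤ p.2}))
    (X : ℝ) :
    ∃ Y : ℝ, ∀ ρ : ℝ, 0 < ρ → ρ ≤ 1 → ∀ g ∈ Subgroup.closure (Prod.fst '' A),
      WLe (insert (t, w) A) ρ g X → WLe A ρ g Y := by
  obtain ⟨K, hK0, hK⟩ := exists_collect hfin hc hw ht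
    (fun p hp => ⟨hw.trans (hA p hp).1, (hA p hp).2⟩) hgen X
  set N := Subgroup.closure (Prod.fst '' A) with hN
  obtain ⟨q, hq⟩ := Int.subgroup_cyclic ((N.comap (zpowersHom G t)).toAddSubgroup')
  have hq' : ∀ a : ℤ, t ^ a ∈ N ↔ a ∈ AddSubgroup.closure {q} := by
    intro a
    rw [← hq]
    rfl
  have hqN : t ^ q ∈ Subgroup.closure (Prod.fst '' {p ∈ A | w ≤ p.2}) := by
    have e : {p ∈ A | w ≤ p.2} = A := Set.sep_eq_self_iff_mem_true.2 fun p hp => (hA p hp).1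
    rw [e]
    exact (hq' q).2 (AddSubgroup.subset_closure rfl)
  obtain ⟨D, hD0, hD⟩ := exists_WLe_of_mem_closure hqN
  refine ⟨D * X + K * X, fun ρ h0 h1 g hg ⟨x, hx, H⟩ => ?_⟩
  obtain ⟨a, h, rfl, ha, hh⟩ := hK ρ h0 h1 g x hx H
  have hhN : h ∈ N := hh.mem_closure
  have haN : t ^ a ∈ N := (Subgroup.mul_mem_cancel_right N hhN).1 hg
  rw [hq', AddSubgroup.mem_closure_singleton] at haN
  obtain ⟨b, rfl⟩ := haN
  refine WLe.mul ?_ (hh.mono (mul_le_mul_of_nonneg_left hx hK0))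
  have hX : 0 ≤ X := (H.nonneg h0.le).trans hx
  rcases eq_or_ne q 0 with rfl | hq0
  · simpa using WLe.one (mul_nonneg hD0 hX)
  rw [smul_eq_mul, mul_comm, zpow_mul]
  refine ((hD ρ h0 h1).zpow b).mono ?_
  have hb : |(b : ℝ)| ≤ |((b • q : ℤ) : ℝ)| := by
    have : (1 : ℝ) ≤ |(q : ℝ)| := by exact_mod_cast Int.one_le_abs hq0
    rw [smul_eq_mul, Int.cast_mul, abs_mul]
    exact le_mul_of_one_le_right (abs_nonneg _) this
  have hb' : |(b : ℝ)| * ρ ^ w ≤ X :=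
    (mul_le_mul_of_nonneg_right hb (by positivity)).trans (ha.trans hx)
  calc |(b : ℝ)| * (D * ρ ^ w) = D * (|(b : ℝ)| * ρ ^ w) := by ring
    _ ≤ D * X := mul_le_mul_of_nonneg_left hb' hD0
/-- Each term of the lower central series of a finitely generated group is finitely generated
modulo the next one. -/
lemma exists_lcs_generators (S : Finset G) (hS : Subgroup.closure (S : Set G) = ⊤) :
    ∃ T : ℕ → Finset G, T 0 = S ∧ (∀ i, ∀ t ∈ T i, t ∈ lcs G i) ∧
      ∀ i, lcs G i ≤ Subgroup.closure (T i : Set G) ⊔ lcs G (i + 1) := by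
  classical
  obtain ⟨T, hT0, hT⟩ : ∃ T : ℕ → Finset G, T 0 = S ∧
      ∀ i, T (i + 1) = Finset.image₂ (fun t s => ⁅t, s⁆) (T i) S :=
    ⟨fun n => Nat.rec S (fun _ Q => Finset.image₂ (fun t s => ⁅t, s⁆) Q S) n, rfl, fun _ => rfl⟩
  have hmem : ∀ i, ∀ t ∈ T i, t ∈ lcs G i := by
    intro i
    induction i with
    | zero => intro t _; exact Subgroup.mem_top t
    | succ i ih =>
      intro t ht
      rw [hT, Finset.mem_image₂] at ht
      obtain ⟨a, ha, b, _, rfl⟩ := ht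
      exact commutator_mem_lcs_succ (ih a ha) b
  refine ⟨T, hT0, hmem, fun i => ?_⟩
  induction i with
  | zero =>
    refine le_sup_of_le_left ?_
    rw [hT0, hS]; exact le_top
  | succ i ih =>
    set K := Subgroup.closure (T (i + 1) : Set G) ⊔ lcs G (i + 1 + 1) with hK
    have hlow : lcs G (i + 1 + 1) ≤ K := le_sup_right
    have hconj : ∀ z ∈ lcs G (i + 1), z ∈ K → ∀ g : G, g * z * g⁻¹ ∈ K := by
      intro z hz hzK g
      have h1 : ⁅z, g⁆⁻¹ ∈ K := inv_mem (hlow (commutator_mem_lcs_succ hz g))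
      rw [commutatorElement_inv] at h1
      have : g * z * g⁻¹ = ⁅g, z⁆ * z := by rw [commutatorElement_def]; group
      rw [this]
      exact mul_mem h1 hzK
    have hsymm : ∀ x g : G, ⁅x, g⁻¹⁆ = g⁻¹ * ⁅x, g⁆⁻¹ * g⁻¹⁻¹ := by
      intro x g; simp only [commutatorElement_def]; group
    have hall : ∀ u ∈ lcs G i, (∀ s ∈ S, ⁅u, s⁆ ∈ K) → ∀ g : G, ⁅u, g⁆ ∈ K := by
      intro u hu hs g
      have hg : g ∈ Subgroup.closure (S : Set G) := hS ▸ Subgroup.mem_top g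
      induction hg using Subgroup.closure_induction with
      | mem x hx => exact hs x hx
      | one => rw [commutatorElement_one_right]; exact one_mem _
      | mul x y _ _ hx hy =>
        have e : ⁅u, x * y⁆ = ⁅u, x⁆ * (x * ⁅u, y⁆ * x⁻¹) := by
          simp only [commutatorElement_def]; group
        rw [e]
        exact mul_mem hx (hconj _ (commutator_mem_lcs_succ hu y) hy x)
      | inv x _ hx =>
        rw [hsymm]
        exact hconj _ (inv_mem (commutator_mem_lcs_succ hu x)) (inv_mem hx) _
    have hT' : ∀ u ∈ Subgroup.closure ((T i : Finset G) : Set G), ∀ g : G, ⁅u, g⁆ ∈ K := by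
      intro u hu
      induction hu using Subgroup.closure_induction with
      | mem x hx =>
        refine hall x (hmem i x hx) fun s hs => ?_
        apply (le_sup_left : Subgroup.closure (T (i + 1) : Set G) ≤ K)
        apply Subgroup.subset_closure
        rw [hT]
        exact Finset.mem_coe.2 (Finset.mem_image₂_of_mem hx hs)
      | one => intro g; rw [commutatorElement_one_left]; exact one_mem _
      | mul x y hx hy ihx ihy =>
        intro g
        have hy' : y ∈ lcs G i := (Subgroup.closure_le (lcs G i)).2 (hmem i) hy
        have e : ⁅x * y, g⁆ = (x * ⁅y, g⁆ * x⁻¹) * ⁅x, g⁆ := by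
          simp only [commutatorElement_def]; group
        rw [e]
        exact mul_mem (hconj _ (commutator_mem_lcs_succ hy' g) (ihy g) x) (ihx g)
      | inv x hx ihx =>
        intro g
        have hx' : x ∈ lcs G i := (Subgroup.closure_le (lcs G i)).2 (hmem i) hx
        have e : ⁅x⁻¹, g⁆ = x⁻¹ * ⁅x, g⁆⁻¹ * x⁻¹⁻¹ := by
          simp only [commutatorElement_def]; group
        rw [e]
        exact hconj _ (inv_mem (commutator_mem_lcs_succ hx' g)) (inv_mem (ihx g)) _
    change ⁅lcs G i, ⊤⁆ ≤ K
    rw [Subgroup.commutator_le]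
    intro u hu g _
    obtain ⟨a, ha, b, hb, rfl⟩ := Subgroup.mem_sup_of_normal_right.1 (ih hu)
    have hb' : b ∈ lcs G i := lcs_antitone (Nat.le_succ i) hb
    have e : ⁅a * b, g⁆ = (a * ⁅b, g⁆ * a⁻¹) * ⁅a, g⁆ := by
      simp only [commutatorElement_def]; group
    rw [e]
    exact mul_mem (hconj _ (commutator_mem_lcs_succ hb' g) (hlow (commutator_mem_lcs_succ hb g)) a)
      (hT' a ha g)

/-- The letters of weight between `v` and `c`. -/
def lettersFrom {α : Type*} (T : ℕ → Finset α) (c v : ℕ) : Set (α × ℕ) :=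
  {p | v ≤ p.2 ∧ p.2 ≤ c ∧ p.1 ∈ T (p.2 - 1)}

lemma lettersFrom_finite {α : Type*} (T : ℕ → Finset α) (c v : ℕ) : (lettersFrom T c v).Finite := by
  classical
  refine (((Finset.range (c + 1)).biUnion fun w => T (w - 1) ×ˢ {w}).finite_toSet).subset ?_
  rintro ⟨t, w⟩ ⟨_, h2, h3⟩
  simp only [Finset.coe_biUnion, Set.mem_iUnion, Finset.mem_coe, Finset.mem_range,
    Finset.mem_product, Finset.mem_singleton]
  exact ⟨w, Nat.lt_succ_of_le h2, h3, rfl⟩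

lemma lcs_le_closure_lettersFrom {T : ℕ → Finset G} {c : ℕ} (hc : lcs G c = ⊥)
    (hT : ∀ i, lcs G i ≤ Subgroup.closure (T i : Set G) ⊔ lcs G (i + 1)) (u : ℕ) (hu : 1 ≤ u) :
    lcs G (u - 1) ≤ Subgroup.closure (Prod.fst '' lettersFrom T c u) := by
  by_cases huc : c < u
  · have : lcs G (u - 1) ≤ lcs G c := lcs_antitone (by omega)
    rw [hc, le_bot_iff] at this
    rw [this]; exact bot_le
  · obtain ⟨k, hk⟩ := Nat.exists_eq_add_of_le (show u ≤ c by omega)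
    induction k generalizing u with
    | zero =>
      have hstep := hT (u - 1)
      rw [show u - 1 + 1 = c by omega, hc, sup_bot_eq] at hstep
      refine hstep.trans (Subgroup.closure_mono ?_)
      intro t ht
      exact ⟨(t, u), ⟨le_refl _, by simp at *; omega, ht⟩, rfl⟩
    | succ k ih =>
      have hstep := hT (u - 1)
      rw [show u - 1 + 1 = u + 1 - 1 by omega] at hstep
      refine hstep.trans (sup_le ?_ ?_)
      · refine Subgroup.closure_mono ?_
        intro t ht
        exact ⟨(t, u), ⟨le_refl _, by simp at *; omega, ht⟩, rfl⟩
      · refine (ih (u + 1) (by omega) (by omega) (by omega)).trans (Subgroup.closure_mono ?_)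
        exact Set.image_mono fun p hp => ⟨by have := hp.1; omega, hp.2⟩

lemma exists_WLe_lettersFrom_succ {T : ℕ → Finset G} {c : ℕ} (hc : lcs G c = ⊥)
    (hmem : ∀ i, ∀ t ∈ T i, t ∈ lcs G i)
    (hT : ∀ i, lcs G i ≤ Subgroup.closure (T i : Set G) ⊔ lcs G (i + 1)) (v : ℕ) (hv : 1 ≤ v)
    (X : ℝ) :
    ∃ Y : ℝ, ∀ ρ : ℝ, 0 < ρ → ρ ≤ 1 → ∀ g ∈ lcs G v,
      WLe (lettersFrom T c v) ρ g X → WLe (lettersFrom T c (v + 1)) ρ g Y := by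
  classical
  set B := lettersFrom T c (v + 1) with hB
  have hgen := lcs_le_closure_lettersFrom hc hT
  have main : ∀ Q : Finset G, Q ⊆ T (v - 1) → ∀ X : ℝ, ∃ Y : ℝ, ∀ ρ : ℝ, 0 < ρ → ρ ≤ 1 →
      ∀ g ∈ lcs G v, WLe (B ∪ (fun t => (t, v)) '' (Q : Set G)) ρ g X → WLe B ρ g Y := by
    intro Q
    induction Q using Finset.induction_on with
    | empty => intro _ X; exact ⟨X, fun ρ _ _ g _ h => by simpa using h⟩
    | insert t Q htQ ih =>
      intro hQ X
      set A := B ∪ (fun t => (t, v)) '' (Q : Set G) with hA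
      have hQ' : Q ⊆ T (v - 1) := (Finset.subset_insert _ _).trans hQ
      obtain ⟨Y, hY⟩ := exists_WLe_eliminate (A := A) (c := c) (w := v) (t := t)
        ((lettersFrom_finite _ _ _).union ((Finset.finite_toSet Q).image _)) hc hv
        (hmem _ _ (hQ (Finset.mem_insert_self _ _))) (by
          rintro p (hp | ⟨s, hs, rfl⟩)
          · exact ⟨by have := hp.1; omega, hmem _ _ hp.2.2⟩
          · exact ⟨le_refl _, hmem _ _ (hQ' hs)⟩) (by
          intro u hu
          refine (hgen u (by omega)).trans (Subgroup.closure_mono (Set.image_mono ?_))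
          intro p hp
          exact ⟨Or.inl ⟨by have := hp.1; omega, hp.2⟩, hp.1⟩) X
      obtain ⟨Z, hZ⟩ := ih hQ' Y
      refine ⟨Z, fun ρ h0 h1 g hg h => hZ ρ h0 h1 g hg (hY ρ h0 h1 g ?_ ?_)⟩
      · exact Subgroup.closure_mono (Set.image_mono Set.subset_union_left)
          (hgen (v + 1) (by omega) (by simpa using hg))
      · rw [Finset.coe_insert, Set.image_insert_eq, Set.union_insert] at h
        exact h
  obtain ⟨Y, hY⟩ := main (T (v - 1)) (le_refl _) X
  refine ⟨Y, fun ρ h0 h1 g hg h => hY ρ h0 h1 g hg (h.mono_set ?_)⟩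
  rintro ⟨t, w⟩ ⟨h1, h2, h3⟩
  rcases eq_or_lt_of_le h1 with h4 | h4
  · simp only at h4
    subst h4
    exact Or.inr ⟨t, h3, rfl⟩
  · exact Or.inl ⟨h4, h2, h3⟩

lemma exists_WLe_lettersFrom {T : ℕ → Finset G} {c : ℕ} (hc : lcs G c = ⊥)
    (hmem : ∀ i, ∀ t ∈ T i, t ∈ lcs G i)
    (hT : ∀ i, lcs G i ≤ Subgroup.closure (T i : Set G) ⊔ lcs G (i + 1)) (v : ℕ) (X : ℝ) :
    ∃ Y : ℝ, ∀ ρ : ℝ, 0 < ρ → ρ ≤ 1 → ∀ g ∈ lcs G v,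
      WLe (lettersFrom T c 1) ρ g X → WLe (lettersFrom T c (v + 1)) ρ g Y := by
  induction v with
  | zero => exact ⟨X, fun ρ _ _ g _ h => h⟩
  | succ v ih =>
    obtain ⟨Y, hY⟩ := ih
    obtain ⟨Z, hZ⟩ := exists_WLe_lettersFrom_succ hc hmem hT (v + 1) (by omega) Y
    exact ⟨Z, fun ρ h0 h1 g hg h =>
      hZ ρ h0 h1 g hg (hY ρ h0 h1 g (lcs_antitone (Nat.le_succ v) hg) h)⟩

/-- Products `t₁ ^ n₁ * ⋯ * t_q ^ n_q` with exponents bounded by `M`. -/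
noncomputable def box [DecidableEq G] : List G → ℕ → Finset G
  | [], _ => {1}
  | t :: l, M => (Finset.Icc (-(M : ℤ)) M).image (fun n => t ^ n) * box l M

section Box
variable [DecidableEq G]

lemma one_mem_box (l : List G) (M : ℕ) : (1 : G) ∈ box l M := by
  induction l with
  | nil => simp [box]
  | cons t l ih =>
    rw [← one_mul (1 : G)]
    refine Finset.mul_mem_mul (Finset.mem_image.2 ⟨0, by simp, by simp⟩) ih

lemma box_mono (l : List G) {M N : ℕ} (h : M ≤ N) : box l M ⊆ box l N := by
  induction l with
  | nil => exact le_refl _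
  | cons t l ih =>
    refine Finset.mul_subset_mul (Finset.image_subset_image ?_) ih
    exact Finset.Icc_subset_Icc (by simpa using h) (by simpa using h)

lemma zpow_mul_mem_box {l : List G} (hl : ∀ t ∈ l, ∀ y : G, Commute t y) {M : ℕ} {t g : G}
    (ht : t ∈ l) {ε : ℤ} (hε : |ε| ≤ 1) (hg : g ∈ box l M) : t ^ ε * g ∈ box l (M + 1) := by
  rw [abs_le] at hε
  induction l generalizing g with
  | nil => simp at ht
  | cons s l ih =>
    obtain ⟨a, ha, b, hb, rfl⟩ := Finset.mem_mul.1 hg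
    obtain ⟨n, hn, rfl⟩ := Finset.mem_image.1 ha
    rw [Finset.mem_Icc] at hn
    rcases List.mem_cons.1 ht with rfl | ht
    · rw [← mul_assoc, ← zpow_add]
      refine Finset.mul_mem_mul (Finset.mem_image.2 ⟨_, ?_, rfl⟩) (box_mono l (Nat.le_succ M) hb)
      rw [Finset.mem_Icc]; push_cast; omega
    · have hc : Commute (t ^ ε) (s ^ n) :=
        (hl t (List.mem_cons_of_mem _ ht) (s ^ n)).zpow_left ε
      rw [← mul_assoc, hc.eq, mul_assoc]
      refine Finset.mul_mem_mul (Finset.mem_image.2 ⟨n, ?_, rfl⟩)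
        (ih (fun u hu => hl u (List.mem_cons_of_mem _ hu)) ht hb)
      rw [Finset.mem_Icc]; push_cast; omega

/-- Boxes of central elements are doubling. -/
lemma exists_card_box_le {l : List G} (hl : ∀ t ∈ l, ∀ y : G, Commute t y) (K : ℕ) :
    ∃ B : ℕ, ∀ M : ℕ, 1 ≤ M → (box l (K * M)).card ≤ B * (box l M).card := by
  suffices h : ∃ B : ℕ, ∀ M : ℕ, 1 ≤ M → ∃ Q : Finset G, Q.card ≤ B ∧
      box l (K * M) ⊆ Q * box l M by
    obtain ⟨B, hB⟩ := h
    refine ⟨B, fun M hM => ?_⟩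
    obtain ⟨Q, hQ, hsub⟩ := hB M hM
    exact (Finset.card_le_card hsub).trans (Finset.card_mul_le.trans (Nat.mul_le_mul_right _ hQ))
  induction l with
  | nil => exact ⟨1, fun M _ => ⟨{1}, by simp, by simp [box]⟩⟩
  | cons t l ih =>
    obtain ⟨B, hB⟩ := ih fun u hu => hl u (List.mem_cons_of_mem _ hu)
    refine ⟨(Finset.Icc (-(K : ℤ)) K).card * B, fun M hM => ?_⟩
    obtain ⟨Q, hQ, hsub⟩ := hB M hM
    refine ⟨(Finset.Icc (-(K : ℤ)) K).image (fun n : ℤ => t ^ (n * (M : ℤ))) * Q, ?_, ?_⟩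
    · exact Finset.card_mul_le.trans (Nat.mul_le_mul Finset.card_image_le hQ)
    · intro g hg
      obtain ⟨a, ha, b, hb, rfl⟩ := Finset.mem_mul.1 hg
      obtain ⟨n, hn, rfl⟩ := Finset.mem_image.1 ha
      obtain ⟨q, hq, b, hb', rfl⟩ := Finset.mem_mul.1 (hsub hb)
      rw [Finset.mem_Icc] at hn
      have hM' : (0 : ℤ) < M := by exact_mod_cast hM
      push_cast at hn
      have e : t ^ n * (q * b) = t ^ (n.tdiv M * M) * q * (t ^ (n.tmod M) * b) := by
        have hc : Commute (t ^ (n.tmod M)) q :=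
          (hl t List.mem_cons_self q).zpow_left _
        have hn' : t ^ n = t ^ (n.tdiv M * M) * t ^ (n.tmod M) := by
          rw [← zpow_add, Int.tdiv_mul_add_tmod]
        rw [hn', mul_assoc, ← mul_assoc (t ^ (n.tmod M)) q b, hc.eq]
        simp only [mul_assoc]
      rw [e]
      refine Finset.mul_mem_mul (Finset.mul_mem_mul (Finset.mem_image.2 ⟨_, ?_, rfl⟩) hq)
        (Finset.mul_mem_mul (Finset.mem_image.2 ⟨_, ?_, rfl⟩) hb')
      · rw [Finset.mem_Icc, ← abs_le]
        have h1 : |n| ≤ K * M := abs_le.2 ⟨by linarith, hn.2⟩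
        have h2 : |n.tdiv M| * M ≤ |n| := by
          rw [Int.abs_eq_natAbs, Int.abs_eq_natAbs, Int.natAbs_tdiv, Int.natAbs_natCast]
          exact_mod_cast Nat.div_mul_le_self n.natAbs M
        exact le_of_mul_le_mul_right (h2.trans h1) hM'
      · rw [Finset.mem_Icc, ← abs_le]
        rw [Int.abs_eq_natAbs, Int.natAbs_tmod, Int.natAbs_natCast]
        exact_mod_cast (Nat.mod_lt n.natAbs hM).le

end Box
lemma WCost.exists_mem_box [DecidableEq G] {T : Finset G} (hT : ∀ t ∈ T, ∀ y : G, Commute t y)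
    {A : Set (G × ℕ)} {w : ℕ} (hA : ∀ p ∈ A, p.1 ∈ T ∧ p.2 = w) {ρ : ℝ} {g : G} {x : ℝ}
    (H : WCost A ρ g x) : ∃ N : ℕ, x = N * ρ ^ w ∧ g ∈ box T.toList N := by
  have hT' : ∀ t ∈ T.toList, ∀ y : G, Commute t y := fun t ht => hT t (Finset.mem_toList.1 ht)
  induction H with
  | one => exact ⟨0, by simp, one_mem_box _ _⟩
  | @mul p g x hp _ ih =>
    obtain ⟨N, rfl, hN⟩ := ih
    refine ⟨N + 1, by rw [(hA p hp).2]; push_cast; ring, ?_⟩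
    have := zpow_mul_mem_box hT' (Finset.mem_toList.2 (hA p hp).1) (ε := 1) (by simp) hN
    simpa using this
  | @inv p g x hp _ ih =>
    obtain ⟨N, rfl, hN⟩ := ih
    refine ⟨N + 1, by rw [(hA p hp).2]; push_cast; ring, ?_⟩
    have := zpow_mul_mem_box hT' (Finset.mem_toList.2 (hA p hp).1) (ε := -1) (by simp) hN
    simpa using this

lemma WCost.of_mem_pow [DecidableEq G] {S : Finset G} {A : Set (G × ℕ)}
    (hA : ∀ s ∈ S, (s, 1) ∈ A) (ρ : ℝ) (n : ℕ) : ∀ g ∈ S ^ n, WCost A ρ g (n * ρ) := by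
  induction n with
  | zero => intro g hg; simp at hg; subst hg; simpa using WCost.one
  | succ n ih =>
    intro g hg
    rw [pow_succ', Finset.mem_mul] at hg
    obtain ⟨s, hs, h, hh, rfl⟩ := hg
    have := WCost.mul (hA s hs) (ih h hh)
    convert this using 1
    push_cast; ring

/-- The elements of word length `n` in the last nontrivial term of the lower central series lie in
a box of size `O(n ^ (c + 1))`. -/
lemma exists_mem_box_of_mem_lcs [DecidableEq G] {S : Finset G}
    (hS : Subgroup.closure (S : Set G) = ⊤) {c : ℕ} (hc : lcs G (c + 1) = ⊥) :
    ∃ (T : Finset G) (K : ℕ), (∀ t ∈ T, t ∈ lcs G c) ∧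
      ∀ n : ℕ, 1 ≤ n → ∀ g ∈ S ^ n, g ∈ lcs G c → g ∈ box T.toList (K * n ^ (c + 1)) := by
  obtain ⟨T, rfl, hmem, hT⟩ := exists_lcs_generators S hS
  obtain ⟨Y, hY⟩ := exists_WLe_lettersFrom hc hmem hT c 1
  refine ⟨T c, ⌈Y⌉₊, hmem c, fun n hn g hg hgc => ?_⟩
  have hn0 : (0 : ℝ) < n := by exact_mod_cast hn
  have hρ1 : (n : ℝ)⁻¹ ≤ 1 := inv_le_one_of_one_le₀ (by exact_mod_cast hn)
  have h1 : WLe (lettersFrom T (c + 1) 1) (n : ℝ)⁻¹ g 1 := by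
    refine ⟨_, ?_, WCost.of_mem_pow (S := T 0)
      (A := lettersFrom T (c + 1) 1) (fun s hs => ⟨le_refl _, by simp, hs⟩) _ n g hg⟩
    rw [mul_inv_cancel₀ hn0.ne']
  obtain ⟨x, hx, H⟩ := hY _ (inv_pos.2 hn0) hρ1 g hgc h1
  obtain ⟨N, rfl, hN⟩ := H.exists_mem_box (T := T c) (w := c + 1)
    (fun t ht => central_of_lcs_succ_eq_bot hc (hmem c t ht)) (by
      rintro p ⟨h1, h2, h3⟩
      have : p.2 = c + 1 := by omega
      rw [this] at h3
      exact ⟨h3, this⟩)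
  refine box_mono _ ?_ hN
  rw [inv_pow, ← div_eq_mul_inv, div_le_iff₀ (by positivity)] at hx
  have : (N : ℝ) ≤ ((⌈Y⌉₊ * n ^ (c + 1) : ℕ) : ℝ) := by
    push_cast
    exact hx.trans (mul_le_mul_of_nonneg_right (Nat.le_ceil Y) (by positivity))
  exact_mod_cast this

section Pow
variable [DecidableEq G] {S : Finset G}

lemma exists_mem_pow (hSinv : S⁻¹ = S) (hS : Subgroup.closure (S : Set G) = ⊤)
    (g : G) : ∃ n : ℕ, g ∈ S ^ n := by
  have hg : g ∈ Subgroup.closure (S : Set G) := hS ▸ Subgroup.mem_top g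
  induction hg using Subgroup.closure_induction with
  | mem x hx => exact ⟨1, by simpa using hx⟩
  | one => exact ⟨0, by simp⟩
  | mul x y _ _ hx hy =>
    obtain ⟨m, hm⟩ := hx
    obtain ⟨n, hn⟩ := hy
    exact ⟨m + n, by rw [pow_add]; exact Finset.mul_mem_mul hm hn⟩
  | inv x _ hx =>
    obtain ⟨m, hm⟩ := hx
    refine ⟨m, ?_⟩
    rw [← hSinv, inv_pow, Finset.mem_inv']
    simpa using hm

lemma inv_mem_pow (hSinv : S⁻¹ = S) {n : ℕ} {g : G} (hg : g ∈ S ^ n) : g⁻¹ ∈ S ^ n := by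
  rw [← hSinv, inv_pow, Finset.mem_inv']
  simpa using hg

lemma pow_subset_pow_of_le (hS1 : 1 ∈ S) {m n : ℕ} (h : m ≤ n) : S ^ m ⊆ S ^ n :=
  Finset.pow_subset_pow_right hS1 h

lemma mul_mem_pow_add {m n : ℕ} {g h : G} (hg : g ∈ S ^ m) (hh : h ∈ S ^ n) :
    g * h ∈ S ^ (m + n) := by
  rw [pow_add]; exact Finset.mul_mem_mul hg hh

lemma pow_mem_pow_mul {m : ℕ} {g : G} (hg : g ∈ S ^ m) (n : ℕ) : g ^ n ∈ S ^ (m * n) := by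
  rw [pow_mul]; exact Finset.pow_mem_pow hg

lemma commutator_mem_pow (hSinv : S⁻¹ = S) {m n : ℕ} {g h : G} (hg : g ∈ S ^ m) (hh : h ∈ S ^ n) :
    ⁅g, h⁆ ∈ S ^ (m + n + m + n) := by
  rw [commutatorElement_def]
  exact mul_mem_pow_add (mul_mem_pow_add (mul_mem_pow_add hg hh) (inv_mem_pow hSinv hg))
    (inv_mem_pow hSinv hh)

end Pow

lemma commutator_pow_pow {u g : G} (h : ∀ y : G, Commute ⁅u, g⁆ y) (q n : ℕ) :
    ⁅u ^ q, g ^ n⁆ = ⁅u, g⁆ ^ (q * n) := by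
  have e : ∀ m, u * g ^ m * u⁻¹ = ⁅u, g⁆ ^ m * g ^ m := by
    intro m
    rw [← (h g).mul_pow, ← conj_pow]
    congr 1
    rw [commutatorElement_def]; group
  have e2 : ∀ k, u ^ k * g ^ n * (u ^ k)⁻¹ = ⁅u, g⁆ ^ (k * n) * g ^ n := by
    intro k
    induction k with
    | zero => simp
    | succ k ih =>
      calc u ^ (k + 1) * g ^ n * (u ^ (k + 1))⁻¹ = u * (u ^ k * g ^ n * (u ^ k)⁻¹) * u⁻¹ := by
            rw [pow_succ']; group
        _ = u * ⁅u, g⁆ ^ (k * n) * g ^ n * u⁻¹ := by rw [ih]; group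
        _ = ⁅u, g⁆ ^ (k * n) * (u * g ^ n * u⁻¹) := by
            rw [((h u).pow_left (k * n)).symm.eq]; group
        _ = _ := by rw [e, add_one_mul, pow_add]; group
  rw [commutatorElement_def, e2, mul_inv_cancel_right]

lemma commutator_mul_central {u z g : G} (hz : ∀ y : G, Commute z y) : ⁅u * z, g⁆ = ⁅u, g⁆ := by
  rw [commutatorElement_def, commutatorElement_def, mul_inv_rev, mul_assoc u z g, (hz g).eq]
  have := (hz u⁻¹).symm.eq
  group

/-- Distortion of the last nontrivial term of the lower central series. -/
theorem exists_pow_mem_pow (c : ℕ) : ∀ (G : Type*) [Group G] [DecidableEq G] (S : Finset G),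
    1 ∈ S → S⁻¹ = S → Subgroup.closure (S : Set G) = ⊤ → lcs G (c + 1) = ⊥ → ∀ x ∈ lcs G c,
    ∃ C : ℕ, ∀ n N : ℕ, N ≤ n ^ (c + 1) → x ^ N ∈ S ^ (C * n) := by
  induction c with
  | zero =>
    intro G _ _ S hS1 hSinv hS hc x hx
    obtain ⟨C, hC⟩ := exists_mem_pow hSinv hS x
    refine ⟨C, fun n N hN => pow_subset_pow_of_le hS1 ?_ (pow_mem_pow_mul hC N)⟩
    exact Nat.mul_le_mul_left _ (by simpa using hN)
  | succ c ih =>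
    intro G _ _ S hS1 hSinv hS hc x hx
    classical
    have hcen : ∀ z ∈ lcs G (c + 1), ∀ y, Commute z y :=
      fun z hz y => central_of_lcs_succ_eq_bot hc hz y
    have hx' : x ∈ Subgroup.closure {g | ∃ g₁ ∈ lcs G c, ∃ g₂ ∈ (⊤ : Subgroup G), ⁅g₁, g₂⁆ = g} :=
      hx
    clear hx
    induction hx' using Subgroup.closure_induction with
    | one => exact ⟨0, fun n N _ => by simp⟩
    | inv x _ ihx =>
      obtain ⟨C, hC⟩ := ihx
      exact ⟨C, fun n N hN => by rw [inv_pow]; exact inv_mem_pow hSinv (hC n N hN)⟩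
    | mul x y hx _ ihx ihy =>
      obtain ⟨C, hC⟩ := ihx
      obtain ⟨D, hD⟩ := ihy
      refine ⟨C + D, fun n N hN => ?_⟩
      rw [(hcen x hx y).mul_pow, add_mul]
      exact mul_mem_pow_add (hC n N hN) (hD n N hN)
    | mem x hx =>
      obtain ⟨u, hu, g, -, rfl⟩ := hx
      set Z := lcs G (c + 1) with hZ
      let π := QuotientGroup.mk' Z
      have hπS : Subgroup.closure ((S.image π : Finset (G ⧸ Z)) : Set (G ⧸ Z)) = ⊤ := by
        rw [Finset.coe_image, ← MonoidHom.map_closure, hS]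
        exact Subgroup.map_top_of_surjective _ (QuotientGroup.mk'_surjective _)
      obtain ⟨C, hC⟩ := ih (G ⧸ Z) (S.image π)
        (Finset.mem_image.2 ⟨1, hS1, map_one π⟩) (by rw [← Finset.image_inv, hSinv])
        hπS (lcs_quotient_eq_bot (c + 1)) (π u) (by
          have := Subgroup.map_lowerCentralSeries (⊤ : Subgroup G) π c
          rw [Subgroup.map_top_of_surjective _ (QuotientGroup.mk'_surjective _)] at this
          change _ ∈ (⊤ : Subgroup (G ⧸ Z)).lowerCentralSeries c
          rw [← this]
          exact Subgroup.mem_map_of_mem _ hu)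
      obtain ⟨l, hl⟩ := exists_mem_pow hSinv hS g
      have hug : ∀ y, Commute ⁅u, g⁆ y := hcen _ (commutator_mem_lcs_succ hu g)
      have lift : ∀ n q : ℕ, q ≤ n ^ (c + 1) → ∃ v ∈ S ^ (C * n), ∀ m,
          ⁅v, g ^ m⁆ = ⁅u, g⁆ ^ (q * m) := by
        intro n q hq
        have h := hC n q hq
        rw [← Finset.image_pow, Finset.mem_image] at h
        obtain ⟨v, hv, hvu⟩ := h
        refine ⟨v, hv, fun m => ?_⟩
        rw [← map_pow] at hvu
        have hz : (u ^ q)⁻¹ * v ∈ Z := QuotientGroup.eq.1 hvu.symm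
        have e : v = u ^ q * ((u ^ q)⁻¹ * v) := by group
        rw [e, commutator_mul_central (hcen _ hz), commutator_pow_pow hug]
      refine ⟨4 * C + 4 * l, fun n N hN => ?_⟩
      rcases Nat.eq_zero_or_pos n with rfl | hn
      · simp at hN; subst hN; simp
      obtain ⟨v, hv, hvm⟩ := lift n (N / n) (Nat.div_le_of_le_mul (by rw [← pow_succ']; exact hN))
      obtain ⟨v', hv', hvm'⟩ := lift n (N % n)
        ((Nat.mod_lt N hn).le.trans (Nat.le_self_pow (by omega) n))
      have e : ⁅u, g⁆ ^ N = ⁅v, g ^ n⁆ * ⁅v', g ^ 1⁆ := by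
        rw [hvm, hvm', ← pow_add, mul_one, mul_comm, Nat.div_add_mod]
      rw [e]
      have h1 := mul_mem_pow_add (commutator_mem_pow hSinv hv (pow_mem_pow_mul hl n))
        (commutator_mem_pow hSinv hv' (pow_mem_pow_mul hl 1))
      refine pow_subset_pow_of_le hS1 ?_ h1
      have : l ≤ l * n := Nat.le_mul_of_pos_right l hn
      nlinarith

lemma exists_box_subset_pow [DecidableEq G] {S : Finset G} (hS1 : 1 ∈ S) (hSinv : S⁻¹ = S)
    (hS : Subgroup.closure (S : Set G) = ⊤) {c : ℕ} (hc : lcs G (c + 1) = ⊥) (l : List G)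
    (hl : ∀ t ∈ l, t ∈ lcs G c) :
    ∃ C : ℕ, ∀ n : ℕ, ∀ g ∈ box l (n ^ (c + 1)), g ∈ S ^ (C * n) ∧ g ∈ lcs G c := by
  induction l with
  | nil => exact ⟨0, fun n g hg => by simp [box] at hg; subst hg; simp⟩
  | cons t l ih =>
    obtain ⟨C, hC⟩ := ih fun u hu => hl u (List.mem_cons_of_mem _ hu)
    have ht := hl t List.mem_cons_self
    obtain ⟨D, hD⟩ := exists_pow_mem_pow c G S hS1 hSinv hS hc t ht
    refine ⟨D + C, fun n g hg => ?_⟩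
    obtain ⟨a, ha, b, hb, rfl⟩ := Finset.mem_mul.1 hg
    obtain ⟨m, hm, rfl⟩ := Finset.mem_image.1 ha
    obtain ⟨hb1, hb2⟩ := hC n b hb
    refine ⟨?_, mul_mem (zpow_mem ht m) hb2⟩
    rw [add_mul]
    refine mul_mem_pow_add ?_ hb1
    rw [Finset.mem_Icc] at hm
    obtain ⟨k, rfl | rfl⟩ := Int.eq_nat_or_neg m
    · rw [zpow_natCast]
      exact hD n k (by omega)
    · rw [zpow_neg, zpow_natCast]
      exact inv_mem_pow hSinv (hD n k (by omega))

/-- Balls in finitely generated nilpotent groups are doubling. -/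
theorem exists_card_pow_two_mul_le_of_lcs (c : ℕ) : ∀ (G : Type*) [Group G] [DecidableEq G]
    (S : Finset G), 1 ∈ S → S⁻¹ = S → Subgroup.closure (S : Set G) = ⊤ → lcs G c = ⊥ →
    ∃ K : ℕ, ∀ n : ℕ, (S ^ (2 * n)).card ≤ K * (S ^ n).card := by
  induction c with
  | zero =>
    intro G _ _ S hS1 _ _ hc
    have hsub : ∀ x : G, x = 1 := fun x => by
      have : x ∈ lcs G 0 := Subgroup.mem_top x
      rwa [hc, Subgroup.mem_bot] at this
    refine ⟨1, fun n => ?_⟩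
    rw [one_mul]
    refine Finset.card_le_card fun x _ => ?_
    rw [hsub x]; exact Finset.one_mem_pow hS1
  | succ c ih =>
    intro G _ _ S hS1 hSinv hS hc
    classical
    set Z := lcs G c with hZ
    let π := QuotientGroup.mk' Z
    have hπS : Subgroup.closure ((S.image π : Finset (G ⧸ Z)) : Set (G ⧸ Z)) = ⊤ := by
      rw [Finset.coe_image, ← MonoidHom.map_closure, hS]
      exact Subgroup.map_top_of_surjective _ (QuotientGroup.mk'_surjective _)
    obtain ⟨K₁, hK₁⟩ := ih (G ⧸ Z) (S.image π)
        (Finset.mem_image.2 ⟨1, hS1, map_one π⟩) (by rw [← Finset.image_inv, hSinv])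
        hπS (lcs_quotient_eq_bot c)
    obtain ⟨T, K₂, hT, hK₂⟩ := exists_mem_box_of_mem_lcs hS hc
    have hT' : ∀ t ∈ T.toList, t ∈ lcs G c := fun t ht => hT t (Finset.mem_toList.1 ht)
    obtain ⟨C, hC⟩ := exists_box_subset_pow hS1 hSinv hS hc T.toList hT'
    obtain ⟨B, hB⟩ := exists_card_box_le (l := T.toList)
      (fun t ht => central_of_lcs_succ_eq_bot hc (hT' t ht)) (K₂ * (32 * (C + 1)) ^ (c + 1))
    have hpos : ∀ n, 1 ≤ (S ^ n).card := fun n =>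
      Finset.card_pos.2 ⟨1, Finset.one_mem_pow hS1⟩
    refine ⟨(S ^ (4 * (C + 2))).card + K₁ ^ 3 * B, fun n => ?_⟩
    by_cases hn : n < 2 * (C + 2)
    · calc (S ^ (2 * n)).card ≤ (S ^ (4 * (C + 2))).card * 1 := by
            rw [mul_one]
            exact Finset.card_le_card (pow_subset_pow_of_le hS1 (by omega))
        _ ≤ _ := Nat.mul_le_mul (Nat.le_add_right _ _) (hpos n)
    set m := n / 2 with hm
    have hm1 : C + 2 ≤ m := by omega
    set p := m / (C + 1) with hp
    have hp1 : 1 ≤ p := (Nat.one_le_div_iff (by omega)).2 (by omega)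
    have hpm : (C + 1) * p ≤ m := Nat.mul_div_le m (C + 1)
    have hmp : m ≤ 2 * (C + 1) * p := by
      have := Nat.lt_mul_div_succ m (show 0 < C + 1 by omega)
      rw [← hp] at this
      nlinarith
    have h1 : (S ^ (2 * n)).card ≤
        ((S ^ (2 * n)).image π).card * ((S ^ (4 * n)).filter (· ∈ Z)).card := by
      have := Finset.le_card_quotient_mul_sq_inter_subgroup (H := Z) (A := S ^ (2 * n))
        (by rw [← inv_pow, hSinv])
      rwa [← pow_mul, show 2 * n * 2 = 4 * n by ring] at this
    have h2 : ((S ^ m).image π).card * ((S ^ m).filter (· ∈ Z)).card ≤ (S ^ n).card := by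
      refine Finset.card_pow_quotient_mul_pow_inter_subgroup_le.trans ?_
      exact Finset.card_le_card (pow_subset_pow_of_le hS1 (by omega))
    have h3 : ((S ^ (2 * n)).image π).card ≤ K₁ ^ 3 * ((S ^ m).image π).card := by
      rw [Finset.image_pow, Finset.image_pow]
      have h8 : ((S.image π) ^ (2 * n)).card ≤ ((S.image π) ^ (2 * (2 * (2 * m)))).card :=
        Finset.card_le_card (pow_subset_pow_of_le (Finset.mem_image.2 ⟨1, hS1, map_one π⟩)
          (by omega))
      calc _ ≤ _ := h8
        _ ≤ K₁ * (K₁ * (K₁ * ((S.image π) ^ m).card)) := by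
            refine (hK₁ _).trans (Nat.mul_le_mul_left _ ((hK₁ _).trans ?_))
            exact Nat.mul_le_mul_left _ (hK₁ _)
        _ = _ := by ring
    have h4 : ((S ^ (4 * n)).filter (· ∈ Z)).card ≤ B * ((S ^ m).filter (· ∈ Z)).card := by
      calc ((S ^ (4 * n)).filter (· ∈ Z)).card
          ≤ (box T.toList (K₂ * (32 * (C + 1)) ^ (c + 1) * p ^ (c + 1))).card := by
            refine Finset.card_le_card fun g hg => ?_
            rw [Finset.mem_filter] at hg
            refine box_mono _ ?_ (hK₂ (4 * n) (by omega) g hg.1 hg.2)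
            rw [mul_assoc, ← mul_pow]
            refine Nat.mul_le_mul_left _ (Nat.pow_le_pow_left ?_ _)
            have : n ≤ 4 * m := by omega
            nlinarith
        _ ≤ B * (box T.toList (p ^ (c + 1))).card := hB _ (Nat.one_le_pow _ _ hp1)
        _ ≤ B * ((S ^ m).filter (· ∈ Z)).card := by
            refine Nat.mul_le_mul_left _ (Finset.card_le_card fun g hg => ?_)
            obtain ⟨h5, h6⟩ := hC p g hg
            rw [Finset.mem_filter]
            refine ⟨pow_subset_pow_of_le hS1 ?_ h5, h6⟩
            nlinarith
    calc (S ^ (2 * n)).card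
        ≤ (K₁ ^ 3 * ((S ^ m).image π).card) * (B * ((S ^ m).filter (· ∈ Z)).card) :=
          h1.trans (Nat.mul_le_mul h3 h4)
      _ = K₁ ^ 3 * B * (((S ^ m).image π).card * ((S ^ m).filter (· ∈ Z)).card) := by ring
      _ ≤ K₁ ^ 3 * B * (S ^ n).card := Nat.mul_le_mul_left _ h2
      _ ≤ _ := Nat.mul_le_mul_right _ (Nat.le_add_left _ _)

end Growth

section Walk
open Function

section Support
variable {α : Type*}

@[fun_prop]
lemma hasFiniteSupport_sq {f : α → ℝ} (hf : HasFiniteSupport f) :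
    HasFiniteSupport fun x => f x ^ 2 :=
  hf.fun_comp (g := fun t => t ^ 2) (zero_pow two_ne_zero)

@[fun_prop]
lemma hasFiniteSupport_div {f : α → ℝ} (hf : HasFiniteSupport f) (c : ℝ) :
    HasFiniteSupport fun x => f x / c :=
  hf.fun_comp (g := fun t => t / c) (zero_div c)

lemma finsum_mono {f g : α → ℝ} (hf : HasFiniteSupport f) (hg : HasFiniteSupport g)
    (h : ∀ x, f x ≤ g x) : ∑ᶠ x, f x ≤ ∑ᶠ x, g x :=
  finsum_le_finsum' hf hg h

end Support

variable {G : Type*} [Group G] {ι : Type*} [Fintype ι]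

/-- The averaging operator of the random walk with steps `σ`. -/
noncomputable def walkOp (σ : ι → G) (f : G → ℝ) : G → ℝ :=
  fun x => (∑ i, f (x * σ i)) / Fintype.card ι

variable {σ : ι → G}

lemma hasFiniteSupport_mul_right {f : G → ℝ} (hf : HasFiniteSupport f) (y : G) :
    HasFiniteSupport fun x => f (x * y) :=
  hf.fun_comp_of_injective (mul_left_injective y)

@[fun_prop]
lemma hasFiniteSupport_walkOp {f : G → ℝ} (hf : HasFiniteSupport f) :
    HasFiniteSupport (walkOp σ f) := by
  unfold walkOp
  fun_prop (disch := exact mul_left_injective _)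

lemma hasFiniteSupport_walkOp_iterate {f : G → ℝ} (hf : HasFiniteSupport f) (n : ℕ) :
    HasFiniteSupport ((walkOp σ)^[n] f) := by
  induction n with
  | zero => exact hf
  | succ n ih => rw [iterate_succ_apply']; fun_prop

lemma finsum_mul_right_eq (f : G → ℝ) (y : G) : ∑ᶠ x, f (x * y) = ∑ᶠ x, f x :=
  finsum_comp_equiv (Equiv.mulRight y)

lemma walkOp_mono {f g : G → ℝ} (h : ∀ x, f x ≤ g x) (x : G) : walkOp σ f x ≤ walkOp σ g x := by
  unfold walkOp
  gcongr
  exact h _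

lemma walkOp_iterate_mono {f g : G → ℝ} (h : ∀ x, f x ≤ g x) (n : ℕ) (x : G) :
    (walkOp σ)^[n] f x ≤ (walkOp σ)^[n] g x := by
  induction n generalizing x with
  | zero => exact h x
  | succ n ih => rw [iterate_succ_apply', iterate_succ_apply']; exact walkOp_mono ih x

lemma walkOp_const [Nonempty ι] (c : ℝ) : walkOp σ (fun _ => c) = fun _ => c := by
  ext x
  have : (Fintype.card ι : ℝ) ≠ 0 := by simp
  simp [walkOp]

lemma walkOp_iterate_const [Nonempty ι] (c : ℝ) (n : ℕ) :
    (walkOp σ)^[n] (fun _ => c) = fun _ => c :=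
  iterate_fixed (walkOp_const c) n

lemma walkOp_const_mul (c : ℝ) (f : G → ℝ) :
    walkOp σ (fun x => c * f x) = fun x => c * walkOp σ f x := by
  ext x
  simp only [walkOp]
  rw [← Finset.mul_sum, mul_div_assoc]

lemma walkOp_iterate_const_mul (c : ℝ) (f : G → ℝ) (n : ℕ) :
    (walkOp σ)^[n] (fun x => c * f x) = fun x => c * (walkOp σ)^[n] f x := by
  induction n with
  | zero => rfl
  | succ n ih => rw [iterate_succ_apply', ih, walkOp_const_mul, iterate_succ_apply']

lemma walkOp_comp_mul_left (f : G → ℝ) (y : G) :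
    walkOp σ (fun x => f (y * x)) = fun x => walkOp σ f (y * x) := by
  ext x
  simp [walkOp, mul_assoc]

lemma walkOp_iterate_comp_mul_left (f : G → ℝ) (y : G) (n : ℕ) :
    (walkOp σ)^[n] (fun x => f (y * x)) = fun x => (walkOp σ)^[n] f (y * x) := by
  induction n with
  | zero => rfl
  | succ n ih => rw [iterate_succ_apply', ih, walkOp_comp_mul_left, iterate_succ_apply']

section Symmetric
variable {e : ι ≃ ι} (he : ∀ i, σ (e i) = (σ i)⁻¹)
include he

lemma finsum_walkOp_mul {f : G → ℝ} (hf : HasFiniteSupport f) (g : G → ℝ) :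
    ∑ᶠ x, walkOp σ f x * g x = ∑ᶠ x, f x * walkOp σ g x := by
  have h1 : ∀ x, walkOp σ f x * g x = ∑ i, f (x * σ i) * (g x / Fintype.card ι) := by
    intro x
    rw [walkOp, ← Finset.sum_mul]
    ring
  have h2 : ∀ x, f x * walkOp σ g x = ∑ i, f x * (g (x * σ i) / Fintype.card ι) := by
    intro x
    rw [walkOp, ← Finset.mul_sum, Finset.sum_div]
  simp_rw [h1, h2]
  rw [finsum_sum_comm _ _ fun i _ => by
      fun_prop (disch := exact mul_left_injective _),
    finsum_sum_comm _ _ fun i _ => by fun_prop]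
  rw [← e.sum_comp]
  refine Finset.sum_congr rfl fun i _ => ?_
  rw [← finsum_mul_right_eq _ (σ i)]
  refine finsum_congr fun x => ?_
  rw [he, mul_inv_cancel_right]

lemma finsum_walkOp_iterate_mul {f : G → ℝ} (hf : HasFiniteSupport f) (g : G → ℝ) (n : ℕ) :
    ∑ᶠ x, (walkOp σ)^[n] f x * g x = ∑ᶠ x, f x * (walkOp σ)^[n] g x := by
  induction n generalizing f with
  | zero => rfl
  | succ n ih =>
    rw [iterate_succ_apply, ih (by fun_prop), iterate_succ_apply', finsum_walkOp_mul he hf]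

end Symmetric

/-- A quantitative Cauchy-Schwarz inequality for averages. -/
lemma sq_avg_le (a : ι → ℝ) (o : ι) :
    ((∑ i, a i) / Fintype.card ι) ^ 2 ≤
      (∑ i, a i ^ 2) / Fintype.card ι - (∑ i, (a i - a o) ^ 2) / (Fintype.card ι : ℝ) ^ 2 := by
  classical
  set N : ℝ := (Fintype.card ι : ℝ) with hN
  have hNpos : 0 < N := by
    have : Nonempty ι := ⟨o⟩
    simp [hN, Fintype.card_pos]
  have key : (∑ i, (a i - a o)) ^ 2 ≤ (N - 1) * ∑ i, (a i - a o) ^ 2 := by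
    have h1 : ∑ i, (a i - a o) = ∑ i ∈ Finset.univ.erase o, (a i - a o) := by
      rw [Finset.sum_erase]; simp
    have h2 : ∑ i, (a i - a o) ^ 2 = ∑ i ∈ Finset.univ.erase o, (a i - a o) ^ 2 := by
      rw [Finset.sum_erase]; simp
    rw [h1, h2]
    have := sq_sum_le_card_mul_sum_sq (s := Finset.univ.erase o) (f := fun i => a i - a o)
    rw [Finset.card_erase_of_mem (Finset.mem_univ o), Finset.card_univ,
      Nat.cast_sub (Fintype.card_pos_iff.2 ⟨o⟩)] at this
    simpa using this
  have e1 : ∑ i, (a i - a o) = ∑ i, a i - N * a o := by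
    rw [Finset.sum_sub_distrib]; simp [hN]
  have e2 : ∑ i, (a i - a o) ^ 2 = ∑ i, a i ^ 2 - 2 * a o * ∑ i, a i + N * a o ^ 2 := by
    simp_rw [sub_sq]
    rw [Finset.sum_add_distrib, Finset.sum_sub_distrib, Finset.mul_sum]
    simp only [Finset.sum_const, Finset.card_univ, nsmul_eq_mul, ← hN]
    congr 2
    exact Finset.sum_congr rfl fun i _ => by ring
  rw [e1, e2] at key
  rw [e2, div_pow, div_sub_div _ _ hNpos.ne' (by positivity), div_le_div_iff₀ (by positivity)
    (by positivity)]
  have : 0 < N ^ 3 := by positivity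
  nlinarith [mul_le_mul_of_nonneg_left key this.le]

end Walk

section WalkEstimates
open Function

variable {G : Type*} [Group G] {ι : Type*} [Fintype ι] {σ : ι → G}

/-- The energy dissipated in one step. -/
lemma finsum_walkOp_sq_add_le {o : ι} (ho : σ o = 1) {u : G → ℝ} (hu : HasFiniteSupport u) :
    ∑ᶠ x, walkOp σ u x ^ 2 + (∑ i, ∑ᶠ x, (u (x * σ i) - u x) ^ 2) / (Fintype.card ι : ℝ) ^ 2 ≤
      ∑ᶠ x, u x ^ 2 := by
  have : Nonempty ι := ⟨o⟩
  have hN : (Fintype.card ι : ℝ) ≠ 0 := by simp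
  have hv : ∀ i, HasFiniteSupport fun x => u (x * σ i) := fun i => hasFiniteSupport_mul_right hu (σ i)
  have h1 : ∀ x, walkOp σ u x ^ 2 ≤ (∑ i, u (x * σ i) ^ 2) / Fintype.card ι -
      (∑ i, (u (x * σ i) - u x) ^ 2) / (Fintype.card ι : ℝ) ^ 2 := by
    intro x
    have := sq_avg_le (fun i => u (x * σ i)) o
    simpa only [ho, mul_one, walkOp] using this
  have h2 := finsum_mono (by fun_prop (disch := exact mul_left_injective _)) (by fun_prop (disch := exact mul_left_injective _)) h1
  rw [finsum_sub_distrib (by fun_prop (disch := exact mul_left_injective _)) (by fun_prop (disch := exact mul_left_injective _))] at h2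
  simp_rw [div_eq_mul_inv] at h2 ⊢
  rw [← finsum_mul' _ _ (by fun_prop (disch := exact mul_left_injective _)), ← finsum_mul' _ _ (by fun_prop (disch := exact mul_left_injective _)),
    finsum_sum_comm _ _ (by fun_prop (disch := exact mul_left_injective _)), finsum_sum_comm _ _ (by fun_prop (disch := exact mul_left_injective _))] at h2
  have h3 : ∀ i, ∑ᶠ x, u (x * σ i) ^ 2 = ∑ᶠ x, u x ^ 2 := fun i =>
    finsum_mul_right_eq (fun x => u x ^ 2) (σ i)
  simp_rw [h3] at h2
  rw [Finset.sum_const, Finset.card_univ, nsmul_eq_mul, mul_comm (Fintype.card ι : ℝ),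
    mul_inv_cancel_right₀ hN] at h2
  linarith

/-- Growth of a weighted `ℓ²` norm in one step. -/
lemma finsum_weight_mul_walkOp_sq_le {e : ι ≃ ι} (he : ∀ i, σ (e i) = (σ i)⁻¹) {o : ι}
    (ho : σ o = 1) {W : G → ℝ} (hW0 : ∀ x, 0 ≤ W x) {η : ℝ} (hη0 : 0 ≤ η)
    (hηN : η * Fintype.card ι ≤ 1) (hW : ∀ x i, |W (x * σ i) - W x| ≤ η * W x)
    {u : G → ℝ} (hu : HasFiniteSupport u) :
    ∑ᶠ x, W x * walkOp σ u x ^ 2 ≤ (1 + Fintype.card ι / 2 * η ^ 2) * ∑ᶠ x, W x * u x ^ 2 := by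
  have : Nonempty ι := ⟨o⟩
  set N : ℝ := (Fintype.card ι : ℝ) with hNdef
  have hN : 0 < N := by simp [hNdef, Fintype.card_pos]
  have hv : ∀ i, HasFiniteSupport fun x => u (x * σ i) := fun i => hasFiniteSupport_mul_right hu (σ i)
  set U := ∑ᶠ x, W x * u x ^ 2 with hU
  set I : ι → ℝ := fun i => ∑ᶠ x, W x * (u (x * σ i) ^ 2 - u x ^ 2) with hI
  set J : ι → ℝ := fun i => ∑ᶠ x, W x * (u (x * σ i) - u x) ^ 2 with hJ
  have h1 : ∀ x, W x * walkOp σ u x ^ 2 ≤ W x * u x ^ 2 +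
      (N⁻¹ * (∑ i, W x * (u (x * σ i) ^ 2 - u x ^ 2)) -
      (N ^ 2)⁻¹ * (∑ i, W x * (u (x * σ i) - u x) ^ 2)) := by
    intro x
    have h := sq_avg_le (fun i => u (x * σ i)) o
    simp only [ho, mul_one] at h
    have h' := mul_le_mul_of_nonneg_left h (hW0 x)
    refine h'.trans (le_of_eq ?_)
    have e1 : ∑ i, W x * (u (x * σ i) ^ 2 - u x ^ 2) =
        W x * ∑ i, u (x * σ i) ^ 2 - N * (W x * u x ^ 2) := by
      rw [← Finset.mul_sum, Finset.sum_sub_distrib, Finset.sum_const, Finset.card_univ,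
        nsmul_eq_mul, ← hNdef]
      ring
    rw [e1, ← Finset.mul_sum, ← hNdef, mul_sub, mul_sub, inv_mul_cancel_left₀ hN.ne']
    ring
  have h2 : ∑ᶠ x, W x * walkOp σ u x ^ 2 ≤ U + (N⁻¹ * ∑ i, I i - (N ^ 2)⁻¹ * ∑ i, J i) := by
    refine (finsum_mono (by fun_prop (disch := exact mul_left_injective _)) (by fun_prop (disch := exact mul_left_injective _)) h1).trans (le_of_eq ?_)
    rw [finsum_add_distrib (by fun_prop (disch := exact mul_left_injective _)) (by fun_prop (disch := exact mul_left_injective _)),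
      finsum_sub_distrib (by fun_prop (disch := exact mul_left_injective _)) (by fun_prop (disch := exact mul_left_injective _)), ← mul_finsum' _ _ (by fun_prop (disch := exact mul_left_injective _)),
      ← mul_finsum' _ _ (by fun_prop (disch := exact mul_left_injective _)), finsum_sum_comm _ _ (by fun_prop (disch := exact mul_left_injective _)),
      finsum_sum_comm _ _ (by fun_prop (disch := exact mul_left_injective _))]
  have h3 : ∀ i, I i + I (e i) ≤ 2 * N⁻¹ * J i + N * η ^ 2 * U := by
    intro i
    have e1 : I (e i) = ∑ᶠ x, W (x * σ i) * (u x ^ 2 - u (x * σ i) ^ 2) := by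
      rw [hI]
      dsimp only
      rw [← finsum_mul_right_eq (fun x => W x * (u (x * σ (e i)) ^ 2 - u x ^ 2)) (σ i)]
      refine finsum_congr fun x => ?_
      rw [he, mul_inv_cancel_right]
    rw [e1, hJ, hU, hI, ← finsum_add_distrib (by fun_prop (disch := exact mul_left_injective _)) (by fun_prop (disch := exact mul_left_injective _)), mul_finsum' _ _ (by fun_prop (disch := exact mul_left_injective _)),
      mul_finsum' _ _ (by fun_prop (disch := exact mul_left_injective _)), ← finsum_add_distrib (by fun_prop (disch := exact mul_left_injective _)) (by fun_prop (disch := exact mul_left_injective _))]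
    refine finsum_mono (by fun_prop (disch := exact mul_left_injective _)) (by fun_prop (disch := exact mul_left_injective _)) fun x => ?_
    set v := u (x * σ i) - u x with hvdef
    have e2 : u (x * σ i) = v + u x := by rw [hvdef]; ring
    rw [e2]
    have hw := hW x i
    have hx := hW0 x
    calc W x * ((v + u x) ^ 2 - u x ^ 2) + W (x * σ i) * (u x ^ 2 - (v + u x) ^ 2)
        = -((W (x * σ i) - W x) * (v * (v + 2 * u x))) := by ring
      _ ≤ |W (x * σ i) - W x| * |v * (v + 2 * u x)| := by
          rw [← abs_mul]; exact neg_le_abs _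
      _ ≤ η * W x * (v ^ 2 + 2 * |u x| * |v|) := by
          refine mul_le_mul hw ?_ (abs_nonneg _) (by positivity)
          rw [abs_mul]
          calc |v| * |v + 2 * u x| ≤ |v| * (|v| + |2 * u x|) := by gcongr; exact abs_add_le _ _
            _ = _ := by rw [abs_mul, abs_two, ← sq_abs v]; ring
      _ = W x * (η * v ^ 2 + 2 * (η * |u x|) * |v|) := by ring
      _ ≤ W x * (2 * N⁻¹ * v ^ 2 + N * η ^ 2 * u x ^ 2) := by
          refine mul_le_mul_of_nonneg_left ?_ hx
          have a1 : η ≤ N⁻¹ := by rw [← one_div, le_div_iff₀ hN]; exact hηN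
          have a2 : η * v ^ 2 ≤ N⁻¹ * v ^ 2 := by gcongr
          have a3 : 2 * (η * |u x|) * |v| ≤ N⁻¹ * v ^ 2 + N * η ^ 2 * u x ^ 2 := by
            rw [← sq_abs v, ← sq_abs (u x)]
            have : 0 ≤ N⁻¹ * (|v| - N * (η * |u x|)) ^ 2 := by positivity
            have e3 : N⁻¹ * (|v| - N * (η * |u x|)) ^ 2 =
              N⁻¹ * |v| ^ 2 + N * η ^ 2 * |u x| ^ 2 - 2 * (η * |u x|) * |v| := by
              field_simp; ring
            linarith
          linarith
      _ = _ := by ring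
  have h4 : ∑ i, I i + ∑ i, I i ≤ 2 * N⁻¹ * ∑ i, J i + N * (N * η ^ 2 * U) := by
    nth_rewrite 2 [← e.sum_comp]
    rw [← Finset.sum_add_distrib, Finset.mul_sum]
    refine (Finset.sum_le_sum fun i _ => h3 i).trans (le_of_eq ?_)
    rw [Finset.sum_add_distrib, Finset.sum_const, Finset.card_univ, nsmul_eq_mul]
  refine h2.trans ?_
  have h5 : N⁻¹ * ∑ i, I i ≤ (N ^ 2)⁻¹ * ∑ i, J i + N / 2 * η ^ 2 * U := by
    have := mul_le_mul_of_nonneg_left h4 (inv_pos.2 hN).le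
    have e4 : N⁻¹ * (2 * N⁻¹ * ∑ i, J i + N * (N * η ^ 2 * U)) =
      2 * ((N ^ 2)⁻¹ * ∑ i, J i + N / 2 * η ^ 2 * U) := by field_simp
    linarith
  linarith

end WalkEstimates

section Moments
open Function

variable {G : Type*} [Group G] [DecidableEq G]

/-- The word length of an element with respect to a finite set. -/
noncomputable def wordLen (S : Finset G) (x : G) : ℕ := sInf {n | x ∈ S ^ n}

section WordLen
variable {S : Finset G}

@[simp] lemma wordLen_one : wordLen S (1 : G) = 0 :=
  Nat.sInf_eq_zero.2 (Or.inl (by simp))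

lemma wordLen_le {x : G} {n : ℕ} (h : x ∈ S ^ n) : wordLen S x ≤ n := Nat.sInf_le h

variable (hSinv : S⁻¹ = S) (hS : Subgroup.closure (S : Set G) = ⊤)
include hSinv hS

lemma mem_pow_wordLen (x : G) : x ∈ S ^ wordLen S x :=
  Nat.sInf_mem (s := {n | x ∈ S ^ n}) (exists_mem_pow hSinv hS x)

lemma wordLen_le_iff (hS1 : 1 ∈ S) {x : G} {n : ℕ} : wordLen S x ≤ n ↔ x ∈ S ^ n :=
  ⟨fun h => pow_subset_pow_of_le hS1 h (mem_pow_wordLen hSinv hS x), wordLen_le⟩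

lemma wordLen_mul_le (x y : G) : wordLen S (x * y) ≤ wordLen S x + wordLen S y :=
  wordLen_le (mul_mem_pow_add (mem_pow_wordLen hSinv hS x) (mem_pow_wordLen hSinv hS y))

lemma wordLen_inv_le (x : G) : wordLen S x⁻¹ ≤ wordLen S x :=
  wordLen_le (inv_mem_pow hSinv (mem_pow_wordLen hSinv hS x))

end WordLen

lemma card_pow_two_pow_mul_le {S : Finset G} {κ : ℕ}
    (hκ : ∀ n, (S ^ (2 * n)).card ≤ κ * (S ^ n).card) (n j : ℕ) :
    (S ^ (2 ^ j * n)).card ≤ κ ^ j * (S ^ n).card := by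
  induction j with
  | zero => simp
  | succ j ih =>
    calc (S ^ (2 ^ (j + 1) * n)).card = (S ^ (2 * (2 ^ j * n))).card := by ring_nf
      _ ≤ κ * (κ ^ j * (S ^ n).card) := (hκ _).trans (Nat.mul_le_mul_left _ ih)
      _ = _ := by ring

lemma exists_sum_exp_neg_wordLen_le {S : Finset G} (hS1 : 1 ∈ S) (hSinv : S⁻¹ = S)
    (hS : Subgroup.closure (S : Set G) = ⊤) {κ : ℕ}
    (hκ : ∀ n, (S ^ (2 * n)).card ≤ κ * (S ^ n).card) {a : ℝ} (ha : 0 < a) :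
    ∃ C : ℝ, 0 ≤ C ∧ ∀ R : ℕ, 1 ≤ R → ∀ F : Finset G,
      ∑ x ∈ F, Real.exp (-(wordLen S x / (a * R))) ≤ C * (S ^ R).card := by
  set k := κ + 1 with hk
  set D : ℝ := k.factorial * (2 * a) ^ k + 1 with hD
  have hD1 : 1 ≤ D := le_add_of_nonneg_left (by positivity)
  refine ⟨2 * D, by positivity, fun R hR F => ?_⟩
  have hR0 : (0 : ℝ) < R := by exact_mod_cast hR
  set J := F.sup (wordLen S) with hJ
  have point : ∀ x ∈ F, Real.exp (-(wordLen S x / (a * R))) ≤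
      ∑ j ∈ Finset.range (J + 1), D / (2 ^ k) ^ j * if x ∈ S ^ (2 ^ j * R) then 1 else 0 := by
    intro x hx
    have hex : ∃ j, wordLen S x ≤ 2 ^ j * R :=
      ⟨_, Nat.lt_two_pow_self.le.trans (Nat.le_mul_of_pos_right _ hR)⟩
    have hj := Nat.find_spec hex
    have hjJ : Nat.find hex ≤ J := by
      refine (Nat.find_min' hex ?_).trans (Finset.le_sup (f := wordLen S) hx)
      exact Nat.lt_two_pow_self.le.trans (Nat.le_mul_of_pos_right _ hR)
    refine le_trans ?_ (Finset.single_le_sum (f := fun j => D / (2 ^ k) ^ j *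
      if x ∈ S ^ (2 ^ j * R) then (1 : ℝ) else 0) (fun j _ => by positivity)
      (Finset.mem_range.2 (Nat.lt_succ_of_le hjJ)))
    rw [wordLen_le_iff hSinv hS hS1] at hj
    simp only [hj, if_true, mul_one]
    rcases h : Nat.find hex with _ | j
    · rw [pow_zero, div_one]
      exact le_trans (Real.exp_le_one_iff.2 (neg_nonpos.2 (by positivity))) hD1
    · have hlt : 2 ^ j * R < wordLen S x := not_le.1 (Nat.find_min hex (h ▸ Nat.lt_succ_self j))
      have hlt' : (2 : ℝ) ^ j * R < wordLen S x := by exact_mod_cast hlt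
      set y : ℝ := wordLen S x / (a * R) with hy
      have hy1 : 2 ^ (j + 1) / (2 * a) ≤ y := by
        rw [hy, div_le_div_iff₀ (by positivity) (by positivity)]
        have := mul_le_mul_of_nonneg_right hlt'.le (show 0 ≤ 2 * a by positivity)
        refine le_trans (le_of_eq ?_) this
        ring
      have hy0 : 0 < y := lt_of_lt_of_le (by positivity) hy1
      have h1 := Real.pow_div_factorial_le_exp y hy0.le k
      rw [Real.exp_neg]
      calc (Real.exp y)⁻¹ ≤ (y ^ k / k.factorial)⁻¹ := by
            gcongr
        _ ≤ ((2 ^ (j + 1) / (2 * a)) ^ k / k.factorial)⁻¹ := by gcongr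
        _ = k.factorial * (2 * a) ^ k / (2 ^ k) ^ (j + 1) := by
            rw [inv_div, div_pow, div_div_eq_mul_div]
            congr 1
            rw [← pow_mul, ← pow_mul, mul_comm]
        _ ≤ _ := by
            gcongr
            rw [hD]; linarith
  refine (Finset.sum_le_sum point).trans ?_
  rw [Finset.sum_comm]
  have hκ2 : (κ : ℝ) / 2 ^ k ≤ 1 / 2 := by
    rw [div_le_div_iff₀ (by positivity) (by positivity), hk, pow_succ]
    have : (κ : ℝ) ≤ 2 ^ κ := by exact_mod_cast Nat.lt_two_pow_self.le
    linarith
  have hj : ∀ j, ∑ x ∈ F, (D / (2 ^ k) ^ j * if x ∈ S ^ (2 ^ j * R) then (1 : ℝ) else 0) ≤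
      (1 / 2) ^ j * (D * (S ^ R).card) := by
    intro j
    rw [← Finset.mul_sum, Finset.sum_boole]
    have h1 : ((F.filter (· ∈ S ^ (2 ^ j * R))).card : ℝ) ≤ (κ : ℝ) ^ j * (S ^ R).card := by
      have : (F.filter (· ∈ S ^ (2 ^ j * R))).card ≤ κ ^ j * (S ^ R).card := by
        refine le_trans (Finset.card_le_card fun x hx => ?_) (card_pow_two_pow_mul_le hκ R j)
        exact (Finset.mem_filter.1 hx).2
      exact_mod_cast this
    calc _ ≤ D / (2 ^ k) ^ j * ((κ : ℝ) ^ j * (S ^ R).card) := by gcongr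
      _ = (κ / 2 ^ k) ^ j * (D * (S ^ R).card) := by rw [div_pow]; ring
      _ ≤ _ := by gcongr
  refine (Finset.sum_le_sum fun j _ => hj j).trans ?_
  rw [← Finset.sum_mul, mul_assoc]
  gcongr
  exact sum_geometric_two_le _

end Moments

section ExpMoments
open Function

variable {G : Type*} [Group G] [DecidableEq G] {ι : Type*} {σ : ι → G}
  {S : Finset G} (hS1 : 1 ∈ S) (hSinv : S⁻¹ = S) (hS : Subgroup.closure (S : Set G) = ⊤)
  {e : ι ≃ ι} (he : ∀ i, σ (e i) = (σ i)⁻¹) {o : ι} (ho : σ o = 1) (hσ : ∀ i, σ i ∈ S)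

lemma exists_finset_support_subset {α : Type*} {f : α → ℝ} (hf : HasFiniteSupport f) :
    ∃ T : Finset α, support f ⊆ T :=
  ⟨Set.Finite.toFinset (s := support f) hf, (Set.Finite.coe_toFinset _).ge⟩

include hSinv hS hσ in
lemma abs_wordLen_mul_sub_le (x : G) (i : ι) :
    |(wordLen S (x * σ i) : ℝ) - wordLen S x| ≤ 1 := by
  have h1 : wordLen S (σ i) ≤ 1 := wordLen_le (by simpa using hσ i)
  have h2 : wordLen S (σ i)⁻¹ ≤ 1 := (wordLen_inv_le hSinv hS _).trans h1
  have h3 := wordLen_mul_le hSinv hS x (σ i)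
  have h4 := wordLen_mul_le hSinv hS (x * σ i) (σ i)⁻¹
  rw [mul_inv_cancel_right] at h4
  rw [abs_le]
  have h5 : (wordLen S (x * σ i) : ℝ) ≤ wordLen S x + 1 := by exact_mod_cast (by omega)
  have h6 : (wordLen S x : ℝ) ≤ wordLen S (x * σ i) + 1 := by exact_mod_cast (by omega)
  constructor <;> linarith

lemma abs_exp_sub_exp_le {s a b : ℝ} (hs : 0 ≤ s) (hs1 : s ≤ 1) (hab : |a - b| ≤ 1) :
    |Real.exp (s * a) - Real.exp (s * b)| ≤ 2 * s * Real.exp (s * b) := by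
  have h1 : |s * (a - b)| ≤ s := by
    rw [abs_mul, abs_of_nonneg hs]
    exact mul_le_of_le_one_right hs hab
  have h2 := Real.abs_exp_sub_one_le (h1.trans hs1)
  have h3 : Real.exp (s * a) - Real.exp (s * b) =
      (Real.exp (s * (a - b)) - 1) * Real.exp (s * b) := by
    rw [sub_mul, ← Real.exp_add, one_mul]
    ring_nf
  rw [h3, abs_mul, Real.abs_exp]
  gcongr
  linarith

variable [Fintype ι]

include hSinv hS he ho hσ in
lemma finsum_exp_wordLen_mul_walkOp_iterate_sq_le {u : G → ℝ} (hu : HasFiniteSupport u)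
    {R m : ℕ} (hR : 1 ≤ R) (hm : m ≤ R ^ 2) :
    ∑ᶠ x, Real.exp (1 / (2 * Fintype.card ι * R) * wordLen S x) * (walkOp σ)^[m] u x ^ 2 ≤
      Real.exp 1 * ∑ᶠ x, Real.exp (1 / (2 * Fintype.card ι * R) * wordLen S x) * u x ^ 2 := by
  have : Nonempty ι := ⟨o⟩
  have hN : (1 : ℝ) ≤ Fintype.card ι := by exact_mod_cast Fintype.card_pos (α := ι)
  have hR' : (1 : ℝ) ≤ R := by exact_mod_cast hR
  set N : ℝ := (Fintype.card ι : ℝ) with hNdef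
  set s : ℝ := 1 / (2 * N * R) with hs
  have hN0 : N ≠ 0 := by positivity
  have hR0 : (R : ℝ) ≠ 0 := by positivity
  have hs0 : 0 ≤ s := by positivity
  have hsN : 2 * s * N = 1 / R := by rw [hs]; field_simp
  have hsN1 : 2 * s * N ≤ 1 := by
    rw [hsN, div_le_one (by positivity)]; exact hR'
  have hs1 : s ≤ 1 := by nlinarith
  have hW0 : 0 ≤ ∑ᶠ x, Real.exp (s * wordLen S x) * u x ^ 2 :=
    finsum_nonneg fun x => by positivity
  have key : ∀ j, ∑ᶠ x, Real.exp (s * wordLen S x) * (walkOp σ)^[j] u x ^ 2 ≤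
      (1 + N / 2 * (2 * s) ^ 2) ^ j * ∑ᶠ x, Real.exp (s * wordLen S x) * u x ^ 2 := by
    intro j
    induction j with
    | zero => simp
    | succ j ih =>
      rw [iterate_succ_apply', pow_succ', mul_assoc]
      refine (finsum_weight_mul_walkOp_sq_le he ho
        (W := fun x => Real.exp (s * wordLen S x)) (fun x => (Real.exp_pos _).le)
        (by positivity) hsN1 (fun x i => abs_exp_sub_exp_le hs0 hs1
          (abs_wordLen_mul_sub_le hSinv hS hσ x i)) (hasFiniteSupport_walkOp_iterate hu j)).trans ?_
      gcongr
  refine (key m).trans ?_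
  gcongr
  have h1 : N / 2 * (2 * s) ^ 2 ≤ 1 / R ^ 2 := by
    have : (2 * s * N) ^ 2 = 1 / R ^ 2 := by rw [hsN]; ring
    rw [← this]
    nlinarith [sq_nonneg s, mul_nonneg (sq_nonneg s) (sub_nonneg.2 hN), sq_nonneg (s * N)]
  calc (1 + N / 2 * (2 * s) ^ 2) ^ m ≤ Real.exp (1 / R ^ 2) ^ m := by
        gcongr
        linarith [Real.add_one_le_exp (1 / (R : ℝ) ^ 2)]
    _ = Real.exp (m / R ^ 2) := by rw [← Real.exp_nat_mul]; ring_nf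
    _ ≤ _ := by
        gcongr
        rw [div_le_one (by positivity)]
        exact_mod_cast hm

include hS1 hSinv hS he ho hσ in
/-- Exponential moments of the random walk at the diffusive scale are bounded. -/
lemma exists_walkOp_iterate_exp_le {κ : ℕ} (hκ : ∀ n, (S ^ (2 * n)).card ≤ κ * (S ^ n).card) :
    ∃ C : ℝ, ∀ R m : ℕ, 1 ≤ R → m ≤ R ^ 2 →
      (walkOp σ)^[m] (fun x => Real.exp (wordLen S x / (8 * Fintype.card ι * R))) 1 ≤ C := by
  have : Nonempty ι := ⟨o⟩
  have hN : (1 : ℝ) ≤ Fintype.card ι := by exact_mod_cast Fintype.card_pos (α := ι)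
  set N : ℝ := (Fintype.card ι : ℝ) with hNdef
  obtain ⟨C, hC0, hC⟩ := exists_sum_exp_neg_wordLen_le hS1 hSinv hS hκ
    (a := 4 * N) (by positivity)
  refine ⟨Real.exp 1 * Real.sqrt (Real.exp 1 * Real.exp 1 * C), fun R m hR hm => ?_⟩
  have hR' : (1 : ℝ) ≤ R := by exact_mod_cast hR
  have hN0 : N ≠ 0 := by positivity
  have hR0 : (R : ℝ) ≠ 0 := by positivity
  set V : ℝ := ((S ^ R).card : ℝ) with hV
  have hVpos : 0 < V := by
    rw [hV]; exact_mod_cast Finset.card_pos.2 ⟨1, Finset.one_mem_pow hS1⟩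
  set g : G → ℝ := fun x => Real.exp (wordLen S x / (8 * N * R)) with hg
  set f : G → ℝ := fun x => if x ∈ S ^ R then 1 else 0 with hf
  have hfs : support f ⊆ ((S ^ R : Finset G) : Set G) := by
    intro x hx
    by_contra h
    exact hx (if_neg h)
  have hfF : HasFiniteSupport f := (Finset.finite_toSet _).subset hfs
  set h : G → ℝ := (walkOp σ)^[m] f with hh
  have hhF : HasFiniteSupport h := hasFiniteSupport_walkOp_iterate hfF m
  -- the weighted energy of the diffused ball
  have hE : ∑ᶠ x, Real.exp (1 / (2 * N * R) * wordLen S x) * h x ^ 2 ≤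
      Real.exp 1 * (Real.exp 1 * V) := by
    refine (finsum_exp_wordLen_mul_walkOp_iterate_sq_le hSinv hS he ho hσ hfF hR hm).trans ?_
    gcongr
    rw [finsum_eq_sum_of_support_subset (s := S ^ R) _ (by
      intro x hx
      refine hfs fun h0 => hx ?_
      simp [h0])]
    refine (Finset.sum_le_card_nsmul (S ^ R) _ (Real.exp 1) fun x hx => ?_).trans
      (le_of_eq (by rw [nsmul_eq_mul, mul_comm]))
    simp only [hf, hx, if_true, one_pow, mul_one]
    gcongr
    have h1 : (wordLen S x : ℝ) ≤ R := by exact_mod_cast wordLen_le hx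
    rw [one_div_mul_eq_div, div_le_one (by positivity)]
    nlinarith
  have hCS : ∑ᶠ x, h x * g x ≤ Real.sqrt (Real.exp 1 * Real.exp 1 * C) * V := by
    obtain ⟨T, hT⟩ := exists_finset_support_subset hhF
    rw [finsum_eq_sum_of_support_subset (s := T) _ (by
      intro x hx
      exact hT fun h0 => hx (by simp [h0]))]
    rw [finsum_eq_sum_of_support_subset (s := T) _ (by
      intro x hx
      exact hT fun h0 => hx (by simp [h0]))] at hE
    have hcs := Finset.sum_mul_sq_le_sq_mul_sq T
      (fun x => Real.exp (wordLen S x / (4 * N * R)) * h x)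
      (fun x => Real.exp (-(wordLen S x / (8 * N * R))))
    have e1 : ∀ x, Real.exp (wordLen S x / (4 * N * R)) * h x *
        Real.exp (-(wordLen S x / (8 * N * R))) = h x * g x := by
      intro x
      rw [mul_comm (Real.exp _) (h x), mul_assoc, ← Real.exp_add]
      congr 2
      field_simp; ring
    have e2 : ∀ x, (Real.exp (wordLen S x / (4 * N * R)) * h x) ^ 2 =
        Real.exp (1 / (2 * N * R) * wordLen S x) * h x ^ 2 := by
      intro x
      rw [mul_pow, ← Real.exp_nat_mul]
      congr 2
      field_simp; ring
    have e3 : ∀ x, Real.exp (-(wordLen S x / (8 * N * R))) ^ 2 =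
        Real.exp (-(wordLen S x / (4 * N * R))) := by
      intro x
      rw [← Real.exp_nat_mul]
      congr 1
      field_simp; ring
    simp_rw [e1, e2, e3] at hcs
    have hsq : (∑ x ∈ T, h x * g x) ^ 2 ≤ (Real.exp 1 * Real.exp 1 * C) * V ^ 2 := by
      refine hcs.trans (le_trans ?_ (le_of_eq
        (show Real.exp 1 * (Real.exp 1 * V) * (C * V) = _ by ring)))
      gcongr
      exact hC R hR T
    refine (Real.le_sqrt_of_sq_le hsq).trans (le_of_eq ?_)
    rw [Real.sqrt_mul (by positivity), Real.sqrt_sq hVpos.le]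
  rw [hh, finsum_walkOp_iterate_mul he hfF g m, finsum_eq_sum_of_support_subset (s := S ^ R) _ (by
      intro x hx
      refine hfs fun h0 => hx ?_
      simp [h0])] at hCS
  have hlow : ∀ b ∈ S ^ R, (Real.exp 1)⁻¹ * (walkOp σ)^[m] g 1 ≤ f b * (walkOp σ)^[m] g b := by
    intro b hb
    simp only [hf, hb, if_true, one_mul]
    have h1 := congrFun (walkOp_iterate_comp_mul_left (σ := σ) g b m) 1
    simp only [mul_one] at h1
    rw [← h1, ← congrFun (walkOp_iterate_const_mul (σ := σ) (Real.exp 1)⁻¹ g m) 1]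
    refine walkOp_iterate_mono (fun x => ?_) m 1
    simp only [hg, ← Real.exp_neg, ← Real.exp_add]
    gcongr
    have h2 : wordLen S x ≤ R + wordLen S (b * x) := by
      have := wordLen_mul_le hSinv hS b⁻¹ (b * x)
      rw [inv_mul_cancel_left] at this
      exact this.trans (Nat.add_le_add_right
        ((wordLen_inv_le hSinv hS b).trans (wordLen_le hb)) _)
    have h2' : (wordLen S x : ℝ) ≤ R + wordLen S (b * x) := by exact_mod_cast h2
    rw [← sub_nonneg]
    have : (wordLen S (b * x) : ℝ) / (8 * N * R) - (-1 + wordLen S x / (8 * N * R)) =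
      (wordLen S (b * x) + 8 * N * R - wordLen S x) / (8 * N * R) := by field_simp; ring
    rw [this]
    apply div_nonneg _ (by positivity)
    nlinarith
  have hsum := (Finset.sum_le_sum hlow).trans hCS
  rw [Finset.sum_const, nsmul_eq_mul, ← hV, mul_comm V] at hsum
  have := le_of_mul_le_mul_right hsum hVpos
  rwa [inv_mul_le_iff₀ (Real.exp_pos 1)] at this

lemma exists_rpow_le_exp {k : ℝ} (hk : 0 ≤ k) :
    ∃ C : ℝ, 0 ≤ C ∧ ∀ y : ℝ, 0 ≤ y → y ^ k ≤ C * Real.exp y := by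
  obtain ⟨n, hn⟩ := exists_nat_ge k
  refine ⟨1 + n.factorial, by positivity, fun y hy => ?_⟩
  rcases le_total y 1 with h | h
  · calc y ^ k ≤ 1 := Real.rpow_le_one hy h hk
      _ ≤ 1 * Real.exp y := by rw [one_mul]; exact Real.one_le_exp hy
      _ ≤ _ := by gcongr; exact le_add_of_nonneg_right (by positivity)
  · calc y ^ k ≤ y ^ n := by
          rw [← Real.rpow_natCast]
          exact Real.rpow_le_rpow_of_exponent_le h hn
      _ ≤ n.factorial * Real.exp y := by
          have := Real.pow_div_factorial_le_exp y hy n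
          rwa [div_le_iff₀' (by positivity)] at this
      _ ≤ _ := by gcongr; exact le_add_of_nonneg_left zero_le_one

include hS1 hSinv hS he ho hσ in
/-- Moments of the random walk at the diffusive scale. -/
lemma exists_walkOp_iterate_rpow_le {κ : ℕ} (hκ : ∀ n, (S ^ (2 * n)).card ≤ κ * (S ^ n).card)
    {k : ℝ} (hk : 0 ≤ k) :
    ∃ C : ℝ, 0 ≤ C ∧ ∀ R m : ℕ, 1 ≤ R → m ≤ R ^ 2 →
      (walkOp σ)^[m] (fun x => (wordLen S x : ℝ) ^ k) 1 ≤ C * (R : ℝ) ^ k := by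
  have : Nonempty ι := ⟨o⟩
  have hN : (1 : ℝ) ≤ Fintype.card ι := by exact_mod_cast Fintype.card_pos (α := ι)
  obtain ⟨C, hC⟩ := exists_walkOp_iterate_exp_le hS1 hSinv hS he ho hσ hκ
  obtain ⟨D, hD0, hD⟩ := exists_rpow_le_exp hk
  set N : ℝ := (Fintype.card ι : ℝ) with hNdef
  refine ⟨(8 * N) ^ k * (D * max C 0), by positivity, fun R m hR hm => ?_⟩
  have hR' : (1 : ℝ) ≤ R := by exact_mod_cast hR
  have hN0 : N ≠ 0 := by positivity
  have hR0 : (R : ℝ) ≠ 0 := by positivity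
  have h1 : ∀ x, (wordLen S x : ℝ) ^ k ≤
      ((8 * N * R) ^ k * D) * Real.exp (wordLen S x / (8 * N * R)) := by
    intro x
    have := hD (wordLen S x / (8 * N * R)) (by positivity)
    rw [Real.div_rpow (by positivity) (by positivity), div_le_iff₀' (by positivity)] at this
    rwa [mul_assoc]
  refine (walkOp_iterate_mono h1 m 1).trans ?_
  rw [walkOp_iterate_const_mul]
  beta_reduce
  calc _ ≤ (8 * N * R) ^ k * D * max C 0 := by
        gcongr
        exact (hC R m hR hm).trans (le_max_left _ _)
    _ = _ := by rw [Real.mul_rpow (by positivity) (by positivity)]; ring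

end ExpMoments

section HeatKernel
open Function

variable {G : Type*} [Group G] [DecidableEq G] {ι : Type*} [Fintype ι]

/-- The transition probabilities of the random walk started at the identity. -/
noncomputable def heat (σ : ι → G) (n : ℕ) : G → ℝ := (walkOp σ)^[n] (Pi.single 1 1)

/-- The squared `ℓ²` norm of the heat kernel. -/
noncomputable def heatSq (σ : ι → G) (n : ℕ) : ℝ := ∑ᶠ x, heat σ n x ^ 2

variable {σ : ι → G}

lemma heat_succ (n : ℕ) : heat σ (n + 1) = walkOp σ (heat σ n) := iterate_succ_apply' _ _ _

@[fun_prop]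
lemma hasFiniteSupport_heat (n : ℕ) : HasFiniteSupport (heat σ n) :=
  hasFiniteSupport_walkOp_iterate
    ((Set.finite_singleton (1 : G)).subset Pi.support_single_subset) n

lemma heat_nonneg (n : ℕ) (x : G) : 0 ≤ heat σ n x := by
  induction n generalizing x with
  | zero => exact (Pi.single_nonneg.2 (zero_le_one (α := ℝ)) : (0 : G → ℝ) ≤ Pi.single 1 1) x
  | succ n ih => rw [heat_succ]; exact div_nonneg (Finset.sum_nonneg fun i _ => ih _) (by positivity)

lemma heatSq_nonneg (n : ℕ) : 0 ≤ heatSq σ n := finsum_nonneg fun _ => sq_nonneg _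

lemma heatSq_zero : heatSq σ 0 = 1 := by
  rw [heatSq, finsum_eq_single _ 1]
  · simp [heat]
  · intro x hx
    simp [heat, hx]

variable {e : ι ≃ ι} (he : ∀ i, σ (e i) = (σ i)⁻¹) {o : ι} (ho : σ o = 1)

section Symm
include he

lemma walkOp_iterate_apply_one (f : G → ℝ) (n : ℕ) :
    (walkOp σ)^[n] f 1 = ∑ᶠ y, heat σ n y * f y := by
  unfold heat
  rw [finsum_walkOp_iterate_mul he
    ((Set.finite_singleton (1 : G)).subset Pi.support_single_subset), finsum_eq_single _ 1]
  · simp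
  · intro x hx
    simp [hx]

lemma walkOp_iterate_apply (f : G → ℝ) (n : ℕ) (x : G) :
    (walkOp σ)^[n] f x = ∑ᶠ y, heat σ n y * f (x * y) := by
  rw [← walkOp_iterate_apply_one he fun y => f (x * y)]
  have := congrFun (walkOp_iterate_comp_mul_left (σ := σ) f x n) 1
  simpa using this.symm

lemma heat_inv (n : ℕ) (x : G) : heat σ n x⁻¹ = heat σ n x := by
  have h := walkOp_iterate_apply he (Pi.single 1 1) n x⁻¹
  rw [finsum_eq_single _ x] at h
  · simpa [heat] using h
  · intro y hy
    have : x⁻¹ * y ≠ 1 := fun h => hy (inv_mul_eq_one.1 h).symm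
    simp [this]

lemma heat_two_mul (n : ℕ) (x : G) :
    heat σ (2 * n) x = ∑ᶠ y, heat σ n y * heat σ n (y * x) := by
  have h : heat σ (2 * n) x⁻¹ = ∑ᶠ y, heat σ n y * heat σ n (x⁻¹ * y) := by
    rw [← walkOp_iterate_apply he, heat, two_mul, iterate_add_apply]
    rfl
  rw [← heat_inv he, h, ← finsum_comp_equiv (Equiv.inv G)]
  refine finsum_congr fun y => ?_
  rw [Equiv.inv_apply, heat_inv he, ← mul_inv_rev, heat_inv he]

lemma heat_two_mul_one (n : ℕ) : heat σ (2 * n) 1 = heatSq σ n := by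
  rw [heat_two_mul he, heatSq]
  simp [sq]

lemma finsum_heat_sub_sq (n : ℕ) (x : G) :
    ∑ᶠ y, (heat σ n (y * x) - heat σ n y) ^ 2 = 2 * heatSq σ n - 2 * heat σ (2 * n) x := by
  have h1 : HasFiniteSupport fun y => heat σ n (y * x) :=
    hasFiniteSupport_mul_right (hasFiniteSupport_heat n) x
  have h2 : ∀ y, (heat σ n (y * x) - heat σ n y) ^ 2 =
      (heat σ n (y * x) ^ 2 + heat σ n y ^ 2) - 2 * (heat σ n y * heat σ n (y * x)) := by
    intro y; ring
  simp_rw [h2]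
  rw [finsum_sub_distrib (by fun_prop) (by fun_prop), finsum_add_distrib (by fun_prop)
    (by fun_prop), finsum_mul_right_eq (fun y => heat σ n y ^ 2) x, ← mul_finsum (fun y => heat σ n y * heat σ n (y * x)) 2,
    ← heat_two_mul he, heatSq]
  ring

lemma heat_two_mul_le (n : ℕ) (x : G) : heat σ (2 * n) x ≤ heatSq σ n := by
  have h := finsum_heat_sub_sq he n x
  have : 0 ≤ ∑ᶠ y, (heat σ n (y * x) - heat σ n y) ^ 2 := finsum_nonneg fun _ => sq_nonneg _
  linarith

lemma finsum_heat [Nonempty ι] (n : ℕ) : ∑ᶠ x, heat σ n x = 1 := by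
  have h := walkOp_iterate_apply_one he (fun _ => 1) n
  rw [walkOp_iterate_const] at h
  simpa using h.symm

lemma sum_heat_le [Nonempty ι] (n : ℕ) (T : Finset G) : ∑ x ∈ T, heat σ n x ≤ 1 := by
  obtain ⟨T', hT'⟩ := exists_finset_support_subset (hasFiniteSupport_heat (σ := σ) n)
  rw [← finsum_heat he n, finsum_eq_sum_of_support_subset (s := T ∪ T') _
    (hT'.trans (by simp))]
  exact Finset.sum_le_sum_of_subset_of_nonneg Finset.subset_union_left
    fun x _ _ => heat_nonneg n x

end Symm

include ho in
lemma heatSq_succ_add_le (n : ℕ) :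
    heatSq σ (n + 1) + (∑ i, ∑ᶠ x, (heat σ n (x * σ i) - heat σ n x) ^ 2) /
      (Fintype.card ι : ℝ) ^ 2 ≤ heatSq σ n := by
  have := finsum_walkOp_sq_add_le ho (hasFiniteSupport_heat (σ := σ) n)
  rwa [← heat_succ] at this

include ho in
lemma heatSq_antitone : Antitone (heatSq σ) := by
  refine antitone_nat_of_succ_le fun n => ?_
  refine le_trans (le_add_of_nonneg_right ?_) (heatSq_succ_add_le ho n)
  exact div_nonneg (Finset.sum_nonneg fun i _ => finsum_nonneg fun _ => sq_nonneg _) (sq_nonneg _)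

include he in
lemma heat_le_heatSq [Nonempty ι] (n : ℕ) (x : G) : heat σ n x ≤ heatSq σ (n / 2) := by
  obtain h | h := Nat.even_or_odd' n |>.choose_spec
  all_goals
    generalize (Nat.even_or_odd' n).choose = q at h
    subst h
  · simpa using heat_two_mul_le he q x
  · rw [heat_succ, show (2 * q + 1) / 2 = q by omega]
    refine (walkOp_mono (heat_two_mul_le he q) x).trans ?_
    rw [walkOp_const]

include ho in
lemma heat_one_le (n : ℕ) : heat σ n 1 ≤ Fintype.card ι * heat σ (n + 1) 1 := by
  have : Nonempty ι := ⟨o⟩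
  rw [heat_succ, walkOp, mul_div_cancel₀ _ (by simp)]
  have := Finset.single_le_sum (f := fun i => heat σ n (1 * σ i)) (fun i _ => heat_nonneg n _)
    (Finset.mem_univ o)
  simpa [ho] using this

include he ho in
lemma heatSq_le_heat_one (n : ℕ) : heatSq σ (n / 2) ≤ Fintype.card ι * heat σ n 1 := by
  have : Nonempty ι := ⟨o⟩
  have hN : (1 : ℝ) ≤ Fintype.card ι := by exact_mod_cast Fintype.card_pos (α := ι)
  obtain h | h := Nat.even_or_odd' n |>.choose_spec
  all_goals
    generalize (Nat.even_or_odd' n).choose = q at h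
    subst h
  · rw [show 2 * q / 2 = q by omega, heat_two_mul_one he]
    exact le_mul_of_one_le_left (heatSq_nonneg q) hN
  · rw [show (2 * q + 1) / 2 = q by omega, ← heat_two_mul_one he]
    exact heat_one_le ho _

variable {S : Finset G}

lemma finsum_sub_sq_le_of_mem_pow (hσS : ∀ g ∈ S, ∃ i, σ i = g) {u : G → ℝ}
    (hu : HasFiniteSupport u) (r : ℕ) {x : G} (hx : x ∈ S ^ r) :
    ∑ᶠ y, (u (y * x) - u y) ^ 2 ≤ (r : ℝ) ^ 2 * ∑ i, ∑ᶠ y, (u (y * σ i) - u y) ^ 2 := by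
  induction r generalizing x with
  | zero =>
    obtain rfl : x = 1 := by simpa using hx
    simp
  | succ r ih =>
    rw [pow_succ, Finset.mem_mul] at hx
    obtain ⟨y, hy, g, hg, rfl⟩ := hx
    obtain ⟨i, rfl⟩ := hσS g hg
    set D := ∑ i, ∑ᶠ y, (u (y * σ i) - u y) ^ 2 with hD
    have hi : ∑ᶠ z, (u (z * σ i) - u z) ^ 2 ≤ D :=
      Finset.single_le_sum (f := fun i => ∑ᶠ y, (u (y * σ i) - u y) ^ 2)
        (fun i _ => finsum_nonneg fun _ => sq_nonneg _) (Finset.mem_univ i)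
    rcases Nat.eq_zero_or_pos r with rfl | hr
    · obtain rfl : y = 1 := by simpa using hy
      simpa using hi
    have hr' : (0 : ℝ) < r := by exact_mod_cast hr
    have f1 : HasFiniteSupport fun z => u (z * y) := hasFiniteSupport_mul_right hu y
    have f2 : HasFiniteSupport fun z => u (z * (y * σ i)) := hasFiniteSupport_mul_right hu _
    have f2' : HasFiniteSupport fun z => u (z * y * σ i) := by simpa [mul_assoc] using f2
    have hpt : ∀ z, (u (z * (y * σ i)) - u z) ^ 2 ≤
        (1 + r) * (u (z * y * σ i) - u (z * y)) ^ 2 + (1 + 1 / r) * (u (z * y) - u z) ^ 2 := by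
      intro z
      rw [← mul_assoc]
      generalize hb : u (z * y) - u z = b
      generalize ha : u (z * y * σ i) - u (z * y) = a
      have hc : u (z * y * σ i) - u z = a + b := by rw [← ha, ← hb]; ring
      rw [hc, ← sub_nonneg]
      have : (1 + r) * a ^ 2 + (1 + 1 / r) * b ^ 2 - (a + b) ^ 2 = (r * a - b) ^ 2 / r := by
        field_simp; ring
      rw [this]; positivity
    have F1 : HasFiniteSupport fun z => (u (z * y * σ i) - u (z * y)) ^ 2 :=
      hasFiniteSupport_sq (f2'.fun_sub f1)
    have F2 : HasFiniteSupport fun z => (u (z * y) - u z) ^ 2 := hasFiniteSupport_sq (f1.fun_sub hu)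
    have F3 : HasFiniteSupport fun z => (u (z * (y * σ i)) - u z) ^ 2 :=
      hasFiniteSupport_sq (f2.fun_sub hu)
    refine (finsum_mono (by fun_prop) (by fun_prop) hpt).trans ?_
    rw [finsum_add_distrib (by fun_prop) (by fun_prop), ← mul_finsum,
      ← mul_finsum, finsum_mul_right_eq (fun z => (u (z * σ i) - u z) ^ 2) y]
    calc _ ≤ (1 + (r : ℝ)) * D + (1 + 1 / r) * (r ^ 2 * D) := by
          gcongr
          exact ih hy
      _ = _ := by push_cast; field_simp; ring

include ho in
lemma exists_energy_le {n : ℕ} (hn : 1 ≤ n) : ∃ j, n ≤ j ∧ j ≤ 2 * n ∧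
    ∑ i, ∑ᶠ x, (heat σ j (x * σ i) - heat σ j x) ^ 2 ≤
      (Fintype.card ι : ℝ) ^ 2 * heatSq σ n / n := by
  have : Nonempty ι := ⟨o⟩
  have hN : (0 : ℝ) < Fintype.card ι := by exact_mod_cast Fintype.card_pos (α := ι)
  have hn' : (0 : ℝ) < n := by exact_mod_cast hn
  by_contra! h
  have key : ∀ t, t ≤ n + 1 → heatSq σ (n + t) + t * (heatSq σ n / n) ≤ heatSq σ n := by
    intro t ht
    induction t with
    | zero => simp
    | succ t ih =>
      have h1 := ih (by omega)
      have h2 := heatSq_succ_add_le ho (n + t)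
      have h3 := h (n + t) (by omega) (by omega)
      have h4 : heatSq σ n / n ≤ (∑ i, ∑ᶠ x, (heat σ (n + t) (x * σ i) - heat σ (n + t) x) ^ 2) /
          (Fintype.card ι : ℝ) ^ 2 := by
        rw [le_div_iff₀ (by positivity)]
        refine le_trans (le_of_eq ?_) h3.le
        ring
      push_cast
      rw [← add_assoc n]
      linarith
  have h1 := key n (by omega)
  rw [mul_div_cancel₀ _ hn'.ne'] at h1
  have h2 := heatSq_nonneg (σ := σ) (n + n)
  have h3 : heatSq σ (2 * n) = 0 := by rw [two_mul]; linarith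
  have h4 := h (2 * n) (by omega) le_rfl
  have h5 := heatSq_succ_add_le ho (2 * n)
  have h6 : 0 < ∑ i, ∑ᶠ x, (heat σ (2 * n) (x * σ i) - heat σ (2 * n) x) ^ 2 :=
    lt_of_le_of_lt (div_nonneg (mul_nonneg (sq_nonneg _) (heatSq_nonneg n)) hn'.le) h4
  have h7 : 0 < (∑ i, ∑ᶠ x, (heat σ (2 * n) (x * σ i) - heat σ (2 * n) x) ^ 2) /
      (Fintype.card ι : ℝ) ^ 2 := by positivity
  linarith [heatSq_nonneg (σ := σ) (2 * n + 1)]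

include he ho in
lemma card_mul_heatSq_le (hσS : ∀ g ∈ S, ∃ i, σ i = g) (r : ℕ) {n : ℕ} (hn : 1 ≤ n) :
    (S ^ r).card * heatSq σ (2 * n) ≤
      1 + (S ^ r).card * ((r : ℝ) ^ 2 * (Fintype.card ι : ℝ) ^ 2 / (2 * n) * heatSq σ n) := by
  obtain ⟨j, -, hj2, hj⟩ := exists_energy_le (σ := σ) ho hn
  have : Nonempty ι := ⟨o⟩
  have hn' : (0 : ℝ) < n := by exact_mod_cast hn
  have h1 : ∀ x ∈ S ^ r, heatSq σ (2 * n) -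
      (r : ℝ) ^ 2 * (Fintype.card ι : ℝ) ^ 2 / (2 * n) * heatSq σ n ≤ heat σ (2 * j) x := by
    intro x hx
    have h2 := finsum_sub_sq_le_of_mem_pow hσS (hasFiniteSupport_heat (σ := σ) j) r hx
    rw [finsum_heat_sub_sq he] at h2
    have h3 := mul_le_mul_of_nonneg_left hj (sq_nonneg (r : ℝ))
    have h4 := heatSq_antitone ho hj2
    have h5 : (r : ℝ) ^ 2 * (Fintype.card ι : ℝ) ^ 2 / (2 * n) * heatSq σ n =
      (r : ℝ) ^ 2 * ((Fintype.card ι : ℝ) ^ 2 * heatSq σ n / n) / 2 := by field_simp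
    rw [h5]
    linarith
  have h2 := (Finset.sum_le_sum h1).trans (sum_heat_le he _ _)
  rw [Finset.sum_const, nsmul_eq_mul, mul_sub] at h2
  linarith

end HeatKernel

section HeatBounds
open Function

variable {G : Type*} [Group G] [DecidableEq G] {ι : Type*} [Fintype ι] {σ : ι → G}
  {e : ι ≃ ι} (he : ∀ i, σ (e i) = (σ i)⁻¹) {o : ι} (ho : σ o = 1)
  {S : Finset G} (hS1 : 1 ∈ S) (hSinv : S⁻¹ = S) (hS : Subgroup.closure (S : Set G) = ⊤)
  (hσ : ∀ i, σ i ∈ S) (hσS : ∀ g ∈ S, ∃ i, σ i = g)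
  {κ : ℕ} (hκ : ∀ n, (S ^ (2 * n)).card ≤ κ * (S ^ n).card)

include hκ in
lemma one_le_doubling_const : 1 ≤ κ := by
  have h := hκ 0
  simp only [mul_zero, pow_zero, Finset.card_one] at h
  omega

include he ho hS1 hσS hκ in
lemma exists_heatSq_mul_card_le :
    ∃ B : ℝ, 0 ≤ B ∧ ∀ j : ℕ, heatSq σ (4 ^ j) * (S ^ 2 ^ j).card ≤ B := by
  have : Nonempty ι := ⟨o⟩
  have hN : (1 : ℝ) ≤ Fintype.card ι := by exact_mod_cast Fintype.card_pos (α := ι)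
  set N : ℝ := (Fintype.card ι : ℝ) with hNdef
  have hκ1 : (1 : ℝ) ≤ κ := by exact_mod_cast one_le_doubling_const hκ
  obtain ⟨q, hq⟩ := pow_unbounded_of_one_lt (4 * κ * N ^ 2) (show (1 : ℝ) < 4 by norm_num)
  have hVmono : ∀ {a b : ℕ}, a ≤ b → ((S ^ a).card : ℝ) ≤ (S ^ b).card := fun h => by
    exact_mod_cast Finset.card_le_card (pow_subset_pow_of_le hS1 h)
  set B : ℝ := 2 * κ ^ q + (S ^ 2 ^ q).card with hB
  refine ⟨B, by positivity, fun j => ?_⟩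
  have small : ∀ j ≤ q, heatSq σ (4 ^ j) * (S ^ 2 ^ j).card ≤ B := by
    intro j hj
    calc heatSq σ (4 ^ j) * (S ^ 2 ^ j).card ≤ 1 * (S ^ 2 ^ q).card := by
          refine mul_le_mul ?_ (hVmono (Nat.pow_le_pow_right two_pos hj)) (by positivity) zero_le_one
          rw [← heatSq_zero (σ := σ)]
          exact heatSq_antitone ho (Nat.zero_le _)
      _ ≤ B := by rw [hB, one_mul]; exact le_add_of_nonneg_left (by positivity)
  rcases le_total j q with h | h
  · exact small j h
  induction j, h using Nat.le_induction with
  | base => exact small q le_rfl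
  | succ j hj ih =>
    obtain ⟨t, rfl⟩ : ∃ t, j = q + t := ⟨j - q, by omega⟩
    set a := heatSq σ (4 ^ (q + t)) with ha
    have ha0 : 0 ≤ a := heatSq_nonneg _
    have h1 := card_mul_heatSq_le he ho hσS (2 ^ (t + 1)) (n := 4 ^ (q + t))
      (Nat.one_le_pow _ _ (by norm_num))
    set v : ℝ := ((S ^ 2 ^ (t + 1)).card : ℝ) with hv
    have hv0 : 0 < v := by
      rw [hv]; exact_mod_cast Finset.card_pos.2 ⟨1, Finset.one_mem_pow hS1⟩
    have h2 : heatSq σ (4 ^ (q + t + 1)) ≤ heatSq σ (2 * 4 ^ (q + t)) :=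
      heatSq_antitone ho (by rw [pow_succ 4 (q + t)]; omega)
    have h3 : ((S ^ 2 ^ (q + t + 1)).card : ℝ) ≤ κ ^ q * v := by
      have := card_pow_two_pow_mul_le hκ (2 ^ (t + 1)) q
      rw [← pow_add, ← add_assoc] at this
      rw [hv]
      exact_mod_cast this
    have h4 : ((S ^ 2 ^ (q + t + 1)).card : ℝ) ≤ κ * (S ^ 2 ^ (q + t)).card := by
      have := hκ (2 ^ (q + t))
      rw [← pow_succ'] at this
      exact_mod_cast this
    set V' : ℝ := ((S ^ 2 ^ (q + t + 1)).card : ℝ) with hV'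
    have hcoef : ((2 ^ (t + 1) : ℕ) : ℝ) ^ 2 * N ^ 2 / (2 * (4 ^ (q + t) : ℕ)) ≤ 1 / (2 * κ) := by
      have h5 : ((2 ^ (t + 1) : ℕ) : ℝ) ^ 2 = 4 * 4 ^ t := by
        push_cast
        rw [← pow_mul, mul_comm, pow_mul, pow_succ']
        norm_num
      rw [h5, div_le_div_iff₀ (by positivity) (by positivity)]
      push_cast
      rw [pow_add]
      nlinarith [mul_le_mul_of_nonneg_right hq.le (pow_nonneg (show (0 : ℝ) ≤ 4 by norm_num) t)]
    set c₀ := ((2 ^ (t + 1) : ℕ) : ℝ) ^ 2 * N ^ 2 / (2 * (4 ^ (q + t) : ℕ)) with hc₀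
    have h6 : heatSq σ (2 * 4 ^ (q + t)) ≤ 1 / v + c₀ * a := by
      rw [mul_comm v] at h1
      rw [← le_div_iff₀ hv0] at h1
      refine h1.trans (le_of_eq ?_)
      rw [ha]
      field_simp
    calc heatSq σ (4 ^ (q + t + 1)) * V' ≤ (1 / v + c₀ * a) * V' := by
          gcongr
          exact h2.trans h6
      _ = V' / v + c₀ * (a * V') := by ring
      _ ≤ κ ^ q + 1 / (2 * κ) * (a * (κ * (S ^ 2 ^ (q + t)).card)) := by
          gcongr
          rwa [div_le_iff₀ hv0]
      _ = κ ^ q + (a * (S ^ 2 ^ (q + t)).card) / 2 := by field_simp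
      _ ≤ κ ^ q + B / 2 := by gcongr
      _ ≤ B := by
        have : (0 : ℝ) ≤ (S ^ 2 ^ q).card := by positivity
        rw [hB]; linarith

include he ho hS1 hSinv hS hσ hκ in
lemma exists_le_heatSq_mul_card :
    ∃ c : ℝ, 0 < c ∧ ∀ j : ℕ, c ≤ heatSq σ (4 ^ j) * (S ^ 2 ^ j).card := by
  have : Nonempty ι := ⟨o⟩
  have hκ1 : (1 : ℝ) ≤ κ := by exact_mod_cast one_le_doubling_const hκ
  obtain ⟨C, hC0, hC⟩ := exists_walkOp_iterate_rpow_le hS1 hSinv hS he ho hσ hκ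
    (k := 1) zero_le_one
  obtain ⟨Q, hQ⟩ := pow_unbounded_of_one_lt (2 * C) (show (1 : ℝ) < 2 by norm_num)
  refine ⟨1 / (4 * κ ^ Q), by positivity, fun j => ?_⟩
  have h1 := hC (2 ^ j) (4 ^ j) Nat.one_le_two_pow (by
    rw [← pow_mul, mul_comm, pow_mul]; norm_num)
  simp only [Real.rpow_one] at h1
  rw [walkOp_iterate_apply_one he] at h1
  set p := heat σ (4 ^ j) with hp
  set T := S ^ (2 ^ Q * 2 ^ j) with hT
  have hfin : HasFiniteSupport p := hasFiniteSupport_heat _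
  have hρ : (0 : ℝ) < 2 ^ Q * 2 ^ j := by positivity
  have h2 : ∀ x, p x ≤ (if x ∈ T then p x else 0) +
      (2 ^ Q * 2 ^ j : ℝ)⁻¹ * (p x * wordLen S x) := by
    intro x
    have hpx : 0 ≤ p x := heat_nonneg _ x
    split_ifs with hx
    · exact le_add_of_nonneg_right (by positivity)
    · rw [hT, ← wordLen_le_iff hSinv hS hS1, not_le] at hx
      have hx' : (2 ^ Q * 2 ^ j : ℝ) ≤ wordLen S x := by exact_mod_cast hx.le
      rw [zero_add, inv_mul_eq_div, le_div_iff₀ hρ]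
      gcongr
  have hT' : support (fun x => if x ∈ T then p x else 0) ⊆ T := by
    intro x hx
    by_contra h
    exact hx (if_neg h)
  have f1 : HasFiniteSupport fun x => if x ∈ T then p x else 0 := T.finite_toSet.subset hT'
  have h3 := finsum_mono hfin (by fun_prop) h2
  rw [finsum_heat he, finsum_add_distrib f1 (by fun_prop), ← mul_finsum,
    finsum_eq_sum_of_support_subset _ hT'] at h3
  have h4 : (2 ^ Q * 2 ^ j : ℝ)⁻¹ * ∑ᶠ x, p x * wordLen S x ≤ 1 / 2 := by
    rw [inv_mul_eq_div, div_le_iff₀ hρ]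
    push_cast at h1
    nlinarith [pow_pos (two_pos (α := ℝ)) j]
  have h5 : ∑ x ∈ T, (if x ∈ T then p x else 0) = ∑ x ∈ T, p x :=
    Finset.sum_congr rfl fun x hx => if_pos hx
  rw [h5] at h3
  have h6 : (∑ x ∈ T, p x) ^ 2 ≤ T.card * heatSq σ (4 ^ j) := by
    refine sq_sum_le_card_mul_sum_sq.trans ?_
    gcongr
    obtain ⟨T', hT'⟩ := exists_finset_support_subset hfin
    rw [heatSq, finsum_eq_sum_of_support_subset (s := T ∪ T') _ fun x hx => by
      have : x ∈ T' := hT' fun h0 => hx (by simp only [← hp, h0]; simp)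
      simp [this]]
    exact Finset.sum_le_sum_of_subset_of_nonneg Finset.subset_union_left
      fun x _ _ => sq_nonneg _
  have h7 : (T.card : ℝ) ≤ κ ^ Q * (S ^ 2 ^ j).card := by
    exact_mod_cast card_pow_two_pow_mul_le hκ (2 ^ j) Q
  have h8 : (1 / 4 : ℝ) ≤ (∑ x ∈ T, p x) ^ 2 := by nlinarith
  rw [div_le_iff₀ (by positivity)]
  have h9 := mul_le_mul_of_nonneg_right h7 (heatSq_nonneg (σ := σ) (4 ^ j))
  nlinarith

include he ho hS1 hSinv hS hσ hσS hκ in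
/-- Transition probabilities are dominated by the return probability at a comparable time. -/
lemma exists_heat_le_mul_heat_one : ∃ K : ℝ, 0 ≤ K ∧ ∀ n m : ℕ, 8 ≤ n → m ≤ n → n ≤ 4 * m →
    ∀ x, heat σ m x ≤ K * heat σ n 1 := by
  have : Nonempty ι := ⟨o⟩
  have hN : (1 : ℝ) ≤ Fintype.card ι := by exact_mod_cast Fintype.card_pos (α := ι)
  set N : ℝ := (Fintype.card ι : ℝ) with hNdef
  have hκ1 : (1 : ℝ) ≤ κ := by exact_mod_cast one_le_doubling_const hκ
  obtain ⟨B, hB0, hB⟩ := exists_heatSq_mul_card_le he ho hS1 hσS hκ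
  obtain ⟨c, hc0, hc⟩ := exists_le_heatSq_mul_card he ho hS1 hSinv hS hσ hκ
  refine ⟨B / c * κ ^ 3 * N, by positivity, fun n m hn hmn hnm x => ?_⟩
  have hh : m / 2 ≠ 0 := by omega
  set j := Nat.log 4 (m / 2) with hj
  have hj1 : 4 ^ j ≤ m / 2 := Nat.pow_log_le_self 4 hh
  have hj2 : m / 2 < 4 ^ (j + 1) := Nat.lt_pow_succ_log_self (by norm_num) _
  have hj3 : n / 2 ≤ 4 ^ (j + 3) := by
    have : 4 ^ (j + 3) = 16 * 4 ^ (j + 1) := by ring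
    omega
  have hV : (0 : ℝ) < (S ^ 2 ^ j).card := by
    exact_mod_cast Finset.card_pos.2 ⟨1, Finset.one_mem_pow hS1⟩
  have h1 : heat σ m x ≤ B / (S ^ 2 ^ j).card := by
    rw [le_div_iff₀ hV]
    refine le_trans ?_ (hB j)
    gcongr
    exact (heat_le_heatSq he m x).trans (heatSq_antitone ho hj1)
  have h2 : c / (κ ^ 3 * (S ^ 2 ^ j).card) ≤ N * heat σ n 1 := by
    rw [div_le_iff₀ (by positivity)]
    refine (hc (j + 3)).trans ?_
    have h3 : ((S ^ 2 ^ (j + 3)).card : ℝ) ≤ κ ^ 3 * (S ^ 2 ^ j).card := by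
      have := card_pow_two_pow_mul_le hκ (2 ^ j) 3
      rw [← pow_add, add_comm 3] at this
      exact_mod_cast this
    have h4 := (heatSq_antitone ho hj3).trans (heatSq_le_heat_one he ho n)
    have h5 := heatSq_nonneg (σ := σ) (4 ^ (j + 3))
    gcongr
    exact h5.trans h4
  calc heat σ m x ≤ B / (S ^ 2 ^ j).card := h1
    _ = B / c * κ ^ 3 * (c / (κ ^ 3 * (S ^ 2 ^ j).card)) := by field_simp
    _ ≤ B / c * κ ^ 3 * (N * heat σ n 1) := by gcongr
    _ = _ := by ring

end HeatBounds

section WordSums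
open Function

variable {ι : Type*} [Fintype ι]

/-- The sum of `F` over all lists of length `n`. -/
def wordSum : ℕ → (List ι → ℝ) → ℝ
  | 0, F => F []
  | n + 1, F => ∑ i, wordSum n fun l => F (i :: l)

lemma wordSum_eq_sum (n : ℕ) (F : List ι → ℝ) :
    wordSum n F = ∑ w : Fin n → ι, F (List.ofFn w) := by
  induction n generalizing F with
  | zero => simp [wordSum]
  | succ n ih =>
    rw [wordSum, ← (Fin.consEquiv fun _ => ι).sum_comp, Fintype.sum_prod_type]
    refine Finset.sum_congr rfl fun i _ => ?_
    rw [ih]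
    simp [Fin.consEquiv]

lemma wordSum_mono {n : ℕ} {F F' : List ι → ℝ} (h : ∀ l, l.length = n → F l ≤ F' l) :
    wordSum n F ≤ wordSum n F' := by
  induction n generalizing F F' with
  | zero => exact h [] rfl
  | succ n ih => exact Finset.sum_le_sum fun i _ => ih fun l hl => h _ (by simp [hl])

lemma wordSum_congr {n : ℕ} {F F' : List ι → ℝ} (h : ∀ l, l.length = n → F l = F' l) :
    wordSum n F = wordSum n F' :=
  le_antisymm (wordSum_mono fun l hl => (h l hl).le) (wordSum_mono fun l hl => (h l hl).ge)

lemma wordSum_add (n : ℕ) (F F' : List ι → ℝ) :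
    wordSum n (fun l => F l + F' l) = wordSum n F + wordSum n F' := by
  simp_rw [wordSum_eq_sum, Finset.sum_add_distrib]

lemma wordSum_const_mul (n : ℕ) (c : ℝ) (F : List ι → ℝ) :
    wordSum n (fun l => c * F l) = c * wordSum n F := by
  simp_rw [wordSum_eq_sum, Finset.mul_sum]

lemma wordSum_comm (m n : ℕ) (F : List ι → List ι → ℝ) :
    wordSum m (fun l => wordSum n fun l' => F l l') =
      wordSum n fun l' => wordSum m fun l => F l l' := by
  simp_rw [wordSum_eq_sum]
  exact Finset.sum_comm

lemma wordSum_append (m n : ℕ) (F : List ι → ℝ) :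
    wordSum (m + n) F = wordSum m fun l => wordSum n fun l' => F (l ++ l') := by
  induction m generalizing F with
  | zero => simp [wordSum]
  | succ m ih =>
    rw [show m + 1 + n = m + n + 1 by omega, wordSum, wordSum]
    simp_rw [ih]
    rfl

variable {G : Type*} [Group G] {σ : ι → G}

lemma wordSum_walkOp [Nonempty ι] (f : G → ℝ) (n : ℕ) (x : G) :
    wordSum n (fun l => f (x * (l.map σ).prod)) =
      (Fintype.card ι : ℝ) ^ n * (walkOp σ)^[n] f x := by
  have hN : (Fintype.card ι : ℝ) ≠ 0 := by simp
  induction n generalizing x with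
  | zero => simp [wordSum]
  | succ n ih =>
    rw [wordSum, iterate_succ_apply', walkOp, mul_div_assoc', pow_succ, mul_assoc, mul_comm _ (∑ i, _),
      ← mul_assoc, mul_div_cancel_right₀ _ hN, Finset.mul_sum]
    refine Finset.sum_congr rfl fun i _ => ?_
    rw [← ih]
    simp [mul_assoc]

variable [DecidableEq G]

/-- Cyclic rotation of closed words. -/
lemma wordSum_closed_window [Nonempty ι] (φ : G → ℝ) (a m t : ℕ) :
    wordSum (a + m + t) (fun l => (Pi.single 1 1 : G → ℝ) (l.map σ).prod *
      φ (((l.drop a).take m).map σ).prod) =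
    wordSum m fun l => φ (l.map σ).prod *
      ((Fintype.card ι : ℝ) ^ (t + a) * heat σ (t + a) (l.map σ).prod) := by
  rw [wordSum_append, wordSum_append, wordSum_comm]
  refine wordSum_congr fun l₂ hl₂ => ?_
  rw [heat, ← wordSum_walkOp, wordSum_append, wordSum_comm t a, ← wordSum_const_mul]
  refine wordSum_congr fun l₁ hl₁ => ?_
  rw [← wordSum_const_mul]
  refine wordSum_congr fun l₃ hl₃ => ?_
  have h1 : ((l₁ ++ l₂ ++ l₃).drop a).take m = l₂ := by
    rw [List.append_assoc, List.drop_left' hl₁, List.take_left' hl₂]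
  rw [h1, mul_comm]
  congr 1
  simp only [List.map_append, List.prod_append, Pi.single_apply]
  congr 1
  rw [mul_assoc, mul_eq_one_iff_eq_inv', eq_comm, ← mul_assoc, mul_eq_one_iff_eq_inv]

lemma wordSum_closed_window_le [Nonempty ι] {φ : G → ℝ} (hφ : ∀ x, 0 ≤ φ x) {K : ℝ} {a m t : ℕ}
    (hK : ∀ x, heat σ (t + a) x ≤ K * heat σ (a + m + t) 1) :
    wordSum (a + m + t) (fun l => (Pi.single 1 1 : G → ℝ) (l.map σ).prod *
      φ (((l.drop a).take m).map σ).prod) ≤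
    K * (walkOp σ)^[m] φ 1 *
      wordSum (a + m + t) (fun l => (Pi.single 1 1 : G → ℝ) (l.map σ).prod) := by
  have h1 := wordSum_walkOp (σ := σ) (Pi.single 1 1) (a + m + t) 1
  simp only [one_mul] at h1
  have h2 := wordSum_walkOp (σ := σ) φ m 1
  simp only [one_mul] at h2
  rw [wordSum_closed_window, h1]
  set N : ℝ := (Fintype.card ι : ℝ) with hN
  calc _ ≤ wordSum m fun l => (N ^ (t + a) * (K * heat σ (a + m + t) 1)) *
        φ (l.map σ).prod := by
        refine wordSum_mono fun l _ => ?_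
        rw [mul_comm]
        refine mul_le_mul_of_nonneg_right ?_ (hφ _)
        gcongr
        exact hK _
    _ = _ := by
        rw [wordSum_const_mul, h2, heat]
        ring

end WordSums

section WindowMoments
open Function

variable {G : Type*} [Group G] [DecidableEq G] {ι : Type*} [Fintype ι] {σ : ι → G}
  {e : ι ≃ ι} (he : ∀ i, σ (e i) = (σ i)⁻¹) {o : ι} (ho : σ o = 1)
  {S : Finset G} (hS1 : 1 ∈ S) (hSinv : S⁻¹ = S) (hS : Subgroup.closure (S : Set G) = ⊤)
  (hσ : ∀ i, σ i ∈ S) (hσS : ∀ g ∈ S, ∃ i, σ i = g)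
  {κ : ℕ} (hκ : ∀ n, (S ^ (2 * n)).card ≤ κ * (S ^ n).card)

include he ho hS1 hSinv hS hσ hσS hκ in
/-- Moments of the displacement along a window of a closed word. -/
lemma exists_wordSum_closed_rpow_le {k : ℝ} (hk : 0 ≤ k) :
    ∃ C : ℝ, 0 ≤ C ∧ ∀ n a m R : ℕ, 8 ≤ n → a + m ≤ n → 1 ≤ R → m ≤ R ^ 2 →
      wordSum n (fun l => (Pi.single 1 1 : G → ℝ) (l.map σ).prod *
        (wordLen S (((l.drop a).take m).map σ).prod : ℝ) ^ k) ≤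
      C * (R : ℝ) ^ k * wordSum n (fun l => (Pi.single 1 1 : G → ℝ) (l.map σ).prod) := by
  have : Nonempty ι := ⟨o⟩
  obtain ⟨C, hC0, hC⟩ := exists_walkOp_iterate_rpow_le hS1 hSinv hS he ho hσ hκ hk
  obtain ⟨K, hK0, hK⟩ := exists_heat_le_mul_heat_one he ho hS1 hSinv hS hσ hσS hκ
  refine ⟨2 ^ k * (2 * (K * C)), by positivity, fun n a m R hn ham hR hm => ?_⟩
  have hδ : ∀ x : G, 0 ≤ (Pi.single 1 1 : G → ℝ) x := fun x => heat_nonneg (σ := σ) 0 x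
  have hZ : 0 ≤ wordSum n (fun l => (Pi.single 1 1 : G → ℝ) (l.map σ).prod) := by
    rw [wordSum_eq_sum]
    exact Finset.sum_nonneg fun _ _ => hδ _
  set Z := wordSum n (fun l => (Pi.single 1 1 : G → ℝ) (l.map σ).prod) with hZdef
  have short : ∀ a m, a + m ≤ n → n ≤ 4 * (n - m) → m ≤ R ^ 2 →
      wordSum n (fun l => (Pi.single 1 1 : G → ℝ) (l.map σ).prod *
        (wordLen S (((l.drop a).take m).map σ).prod : ℝ) ^ k) ≤ K * (C * (R : ℝ) ^ k) * Z := by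
    intro a m ham h4 hm
    obtain ⟨t, rfl⟩ := Nat.exists_eq_add_of_le ham
    refine (wordSum_closed_window_le (φ := fun x => (wordLen S x : ℝ) ^ k)
      (fun x => by positivity) (hK _ _ hn (by omega) (by omega))).trans ?_
    gcongr
    exact hC R m hR hm
  have h1 := short a (m / 2) (by omega) (by omega) (by omega)
  have h2 := short (a + m / 2) (m - m / 2) (by omega) (by omega) (by omega)
  have h3 : ∀ l : List ι, (Pi.single 1 1 : G → ℝ) (l.map σ).prod *
      (wordLen S (((l.drop a).take m).map σ).prod : ℝ) ^ k ≤
      2 ^ k * ((Pi.single 1 1 : G → ℝ) (l.map σ).prod *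
        (wordLen S (((l.drop a).take (m / 2)).map σ).prod : ℝ) ^ k +
        (Pi.single 1 1 : G → ℝ) (l.map σ).prod *
        (wordLen S (((l.drop (a + m / 2)).take (m - m / 2)).map σ).prod : ℝ) ^ k) := by
    intro l
    have e1 : (l.drop a).take m = (l.drop a).take (m / 2) ++
        (l.drop (a + m / 2)).take (m - m / 2) := by
      conv_lhs => rw [show m = m / 2 + (m - m / 2) by omega]
      rw [List.take_add, List.drop_drop]
    rw [e1, List.map_append, List.prod_append]
    set x := (((l.drop a).take (m / 2)).map σ).prod
    set y := (((l.drop (a + m / 2)).take (m - m / 2)).map σ).prod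
    rw [← mul_add, mul_left_comm]
    refine mul_le_mul_of_nonneg_left ?_ (hδ _)
    have hxy : (wordLen S (x * y) : ℝ) ≤ wordLen S x + wordLen S y := by
      exact_mod_cast wordLen_mul_le hSinv hS x y
    have hmax : (wordLen S x : ℝ) + wordLen S y ≤ 2 * max (wordLen S x : ℝ) (wordLen S y) := by
      rw [two_mul]
      exact add_le_add (le_max_left _ _) (le_max_right _ _)
    calc (wordLen S (x * y) : ℝ) ^ k ≤ (2 * max (wordLen S x : ℝ) (wordLen S y)) ^ k :=
          Real.rpow_le_rpow (by positivity) (hxy.trans hmax) hk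
      _ = 2 ^ k * (max (wordLen S x : ℝ) (wordLen S y)) ^ k :=
          Real.mul_rpow (by positivity) (by positivity)
      _ ≤ _ := by
          gcongr
          rcases max_choice (wordLen S x : ℝ) (wordLen S y) with h | h <;> rw [h]
          · exact le_add_of_nonneg_right (by positivity)
          · exact le_add_of_nonneg_left (by positivity)
  refine (wordSum_mono fun l _ => h3 l).trans ?_
  rw [wordSum_const_mul, wordSum_add]
  calc _ ≤ 2 ^ k * (K * (C * (R : ℝ) ^ k) * Z + K * (C * (R : ℝ) ^ k) * Z) := by gcongr
    _ = _ := by ring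

end WindowMoments

section Filling

variable (r : Fin s → FreeGroup (Fin d))

/-- A conjugate of a relator or of its inverse. -/
def relConj (p : FreeGroup (Fin d) × Fin s × Bool) : FreeGroup (Fin d) :=
  p.1⁻¹ * r p.2.1 ^ (if p.2.2 then (1 : ℤ) else -1) * p.1

variable {r}

lemma fillingArea_le {L : List (FreeGroup (Fin d) × Fin s × Bool)} {w : FreeGroup (Fin d)}
    (h : w = (L.map (relConj r)).prod) : fillingArea r w ≤ L.length := by
  refine Nat.sInf_le ⟨fun i => (L.get i).1, fun i => (L.get i).2.1, fun i => (L.get i).2.2, ?_⟩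
  rw [h]
  conv_lhs => rw [← List.ofFn_get L, List.map_ofFn]
  rfl

lemma relConj_not (g : FreeGroup (Fin d)) (i : Fin s) (b : Bool) :
    relConj r (g, i, !b) = (relConj r (g, i, b))⁻¹ := by
  cases b <;> simp [relConj, mul_assoc]

lemma exists_list_relConj {w : FreeGroup (Fin d)} (hw : w ∈ relSubgroup r) :
    ∃ L : List (FreeGroup (Fin d) × Fin s × Bool), w = (L.map (relConj r)).prod := by
  rw [relSubgroup, Subgroup.normalClosure] at hw
  induction hw using Subgroup.closure_induction with
  | mem x hx =>
    obtain ⟨_, ⟨i, rfl⟩, hx⟩ := Group.mem_conjugatesOfSet_iff.1 hx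
    obtain ⟨c, rfl⟩ := isConj_iff.1 hx
    exact ⟨[(c⁻¹, i, true)], by simp [relConj]⟩
  | one => exact ⟨[], rfl⟩
  | mul x y _ _ hx hy =>
    obtain ⟨L, rfl⟩ := hx
    obtain ⟨L', rfl⟩ := hy
    exact ⟨L ++ L', by simp⟩
  | inv x _ hx =>
    obtain ⟨L, rfl⟩ := hx
    refine ⟨(L.map fun p => (p.1, p.2.1, !p.2.2)).reverse, ?_⟩
    rw [List.prod_inv_reverse, List.map_reverse, List.map_map, List.map_map]
    congr 2
    exact List.map_congr_left fun p _ => (relConj_not _ _ _).symm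

lemma exists_list_fillingArea {w : FreeGroup (Fin d)} (hw : w ∈ relSubgroup r) :
    ∃ L : List (FreeGroup (Fin d) × Fin s × Bool),
      L.length = fillingArea r w ∧ w = (L.map (relConj r)).prod := by
  obtain ⟨L₀, hL₀⟩ := exists_list_relConj hw
  obtain ⟨g, a, ε, h⟩ : fillingArea r w ∈ { k | ∃ (g : Fin k → FreeGroup (Fin d))
      (a : Fin k → Fin s) (ε : Fin k → Bool), w = (List.ofFn
        (fun i => (g i)⁻¹ * (r (a i)) ^ (if ε i then (1 : ℤ) else -1) * g i)).prod } := by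
    refine Nat.sInf_mem ⟨L₀.length, fun i => (L₀.get i).1, fun i => (L₀.get i).2.1,
      fun i => (L₀.get i).2.2, ?_⟩
    rw [hL₀]
    conv_lhs => rw [← List.ofFn_get L₀, List.map_ofFn]
    rfl
  refine ⟨List.ofFn fun i => (g i, a i, ε i), by simp, ?_⟩
  rw [List.map_ofFn]
  exact h

lemma fillingArea_mul_le {x y : FreeGroup (Fin d)} (hx : x ∈ relSubgroup r)
    (hy : y ∈ relSubgroup r) : fillingArea r (x * y) ≤ fillingArea r x + fillingArea r y := by
  obtain ⟨L, hL, h⟩ := exists_list_fillingArea hx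
  obtain ⟨L', hL', h'⟩ := exists_list_fillingArea hy
  rw [← hL, ← hL', ← List.length_append]
  exact fillingArea_le (by rw [List.map_append, List.prod_append, ← h, ← h'])

lemma fillingArea_conj_le {x : FreeGroup (Fin d)} (hx : x ∈ relSubgroup r)
    (c : FreeGroup (Fin d)) : fillingArea r (c * x * c⁻¹) ≤ fillingArea r x := by
  obtain ⟨L, hL, h⟩ := exists_list_fillingArea hx
  rw [← hL, ← List.length_map (fun p => (p.1 * c⁻¹, p.2))]
  refine fillingArea_le ?_
  rw [h, ← MulAut.conj_apply, map_list_prod, List.map_map, List.map_map]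
  congr 1
  refine List.map_congr_left fun p _ => ?_
  simp [relConj, mul_assoc]

lemma finite_norm_le (n : ℕ) : {w : FreeGroup (Fin d) | FreeGroup.norm w ≤ n}.Finite :=
  Set.Finite.of_finite_image ((List.finite_length_le (Fin d × Bool) n).subset
    (by rintro _ ⟨w, hw, rfl⟩; exact hw)) FreeGroup.toWord_injective.injOn

lemma fillingArea_le_dehn {w : FreeGroup (Fin d)} (hw : w ∈ relSubgroup r) {n : ℕ}
    (hn : FreeGroup.norm w ≤ n) : fillingArea r w ≤ dehn r n := by
  refine le_csSup (Set.Finite.bddAbove ?_) ⟨w, hw, hn, rfl⟩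
  refine ((finite_norm_le n).image (fillingArea r)).subset ?_
  rintro _ ⟨v, -, hv, rfl⟩
  exact ⟨v, hv, rfl⟩

lemma exists_dehn_le {k : ℝ} (hk : 0 ≤ k)
    (h : ∃ C : ℝ, ∃ N₀ : ℕ, ∀ n : ℕ, N₀ ≤ n → (dehn r n : ℝ) ≤ C * (n : ℝ) ^ k) :
    ∃ C : ℝ, 0 ≤ C ∧ ∀ n : ℕ, (dehn r n : ℝ) ≤ C * (1 + n : ℝ) ^ k := by
  obtain ⟨C, N₀, h⟩ := h
  have hs : (0 : ℝ) ≤ ∑ i ∈ Finset.range N₀, (dehn r i : ℝ) := by positivity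
  refine ⟨|C| + ∑ i ∈ Finset.range N₀, (dehn r i : ℝ), by positivity, fun n => ?_⟩
  rcases lt_or_ge n N₀ with hn | hn
  · have h1 := Finset.single_le_sum (f := fun i => (dehn r i : ℝ)) (fun i _ => by positivity)
      (Finset.mem_range.2 hn)
    have h2 : (1 : ℝ) ≤ (1 + n : ℝ) ^ k := Real.one_le_rpow (by simp) hk
    refine h1.trans ((le_add_of_nonneg_left (abs_nonneg C)).trans ?_)
    exact le_mul_of_one_le_right (by positivity) h2
  · calc (dehn r n : ℝ) ≤ C * (n : ℝ) ^ k := h n hn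
      _ ≤ |C| * (1 + n : ℝ) ^ k := by
          gcongr
          · exact le_abs_self C
          · simp
      _ ≤ _ := by gcongr; exact le_add_of_nonneg_right hs

end Filling

section Letters

/-- Inversion of lazy letters. -/
def letterInv (d : ℕ) : Letter d ≃ Letter d :=
  Equiv.optionCongr (Equiv.prodCongr (Equiv.refl _) Equiv.boolNot)

lemma letterVal_letterInv (l : Letter d) : letterVal (letterInv d l) = (letterVal l)⁻¹ := by
  rcases l with _ | ⟨i, b⟩
  · simp [letterInv, letterVal]
  · cases b <;> simp [letterInv, letterVal]

lemma norm_letterVal_le (l : Letter d) : FreeGroup.norm (letterVal l) ≤ 1 := by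
  rcases l with _ | ⟨i, b⟩
  · simp [letterVal]
  · cases b <;> simp [letterVal]

end Letters

section Quotient

variable (r : Fin s → FreeGroup (Fin d))

/-- The element of the quotient group represented by a lazy letter. -/
def letterQuot (l : Letter d) : FreeGroup (Fin d) ⧸ relSubgroup r := (letterVal l : FreeGroup (Fin d))

lemma letterQuot_letterInv (l : Letter d) :
    letterQuot r (letterInv d l) = (letterQuot r l)⁻¹ := by
  simp [letterQuot, letterVal_letterInv]

lemma letterQuot_none : letterQuot r none = 1 := rfl

lemma prod_map_letterQuot (l : List (Letter d)) :
    (l.map (letterQuot r)).prod = ((l.map letterVal).prod : FreeGroup (Fin d)) := by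
  rw [← QuotientGroup.mk'_apply, map_list_prod, List.map_map]
  rfl

variable [DecidableEq (FreeGroup (Fin d) ⧸ relSubgroup r)]

/-- The symmetric generating set of the quotient group. -/
def genSet : Finset (FreeGroup (Fin d) ⧸ relSubgroup r) := Finset.univ.image (letterQuot r)

lemma letterQuot_mem_genSet (l : Letter d) : letterQuot r l ∈ genSet r :=
  Finset.mem_image_of_mem _ (Finset.mem_univ l)

lemma exists_letterQuot_eq : ∀ g ∈ genSet r, ∃ l, letterQuot r l = g := fun g hg => by
  simpa [genSet] using hg

lemma one_mem_genSet : 1 ∈ genSet r := letterQuot_mem_genSet r none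

open scoped Pointwise in
lemma genSet_inv : (genSet r)⁻¹ = genSet r := by
  have h : ∀ g ∈ genSet r, g⁻¹ ∈ genSet r := fun g hg => by
    obtain ⟨l, rfl⟩ := exists_letterQuot_eq r g hg
    rw [← letterQuot_letterInv]
    exact letterQuot_mem_genSet r _
  ext g
  rw [Finset.mem_inv']
  exact ⟨fun hg => inv_inv g ▸ h _ hg, h g⟩

lemma closure_genSet : Subgroup.closure (genSet r : Set (FreeGroup (Fin d) ⧸ relSubgroup r)) = ⊤ := by
  rw [eq_top_iff, ← Subgroup.map_top_of_surjective _ (QuotientGroup.mk'_surjective (relSubgroup r)),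
    ← FreeGroup.closure_range_of, MonoidHom.map_closure]
  refine Subgroup.closure_mono ?_
  rintro _ ⟨_, ⟨i, rfl⟩, rfl⟩
  exact letterQuot_mem_genSet r (some (i, true))

open scoped Pointwise in
lemma exists_norm_le_of_mem_pow (n : ℕ) : ∀ g ∈ genSet r ^ n,
    ∃ w : FreeGroup (Fin d), (w : FreeGroup (Fin d) ⧸ relSubgroup r) = g ∧ FreeGroup.norm w ≤ n := by
  induction n with
  | zero => exact fun g hg => ⟨1, by simpa [eq_comm] using hg, by simp⟩
  | succ n ih =>
    intro g hg
    rw [pow_succ, Finset.mem_mul] at hg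
    obtain ⟨x, hx, y, hy, rfl⟩ := hg
    obtain ⟨w, rfl, hw⟩ := ih x hx
    obtain ⟨l, rfl⟩ := exists_letterQuot_eq r y hy
    exact ⟨w * letterVal l, rfl,
      (FreeGroup.norm_mul_le _ _).trans (Nat.add_le_add hw (norm_letterVal_le l))⟩

lemma exists_short_representative (g : FreeGroup (Fin d) ⧸ relSubgroup r) :
    ∃ w : FreeGroup (Fin d), (w : FreeGroup (Fin d) ⧸ relSubgroup r) = g ∧
      FreeGroup.norm w ≤ wordLen (genSet r) g :=
  exists_norm_le_of_mem_pow r _ g (mem_pow_wordLen (genSet_inv r) (closure_genSet r) g)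

/-- A short word representing a given element of the quotient group. -/
noncomputable def shortRep (g : FreeGroup (Fin d) ⧸ relSubgroup r) : FreeGroup (Fin d) :=
  (exists_short_representative r g).choose

@[simp] lemma mk_shortRep (g : FreeGroup (Fin d) ⧸ relSubgroup r) :
    (shortRep r g : FreeGroup (Fin d) ⧸ relSubgroup r) = g :=
  (exists_short_representative r g).choose_spec.1

lemma norm_shortRep_le (g : FreeGroup (Fin d) ⧸ relSubgroup r) :
    FreeGroup.norm (shortRep r g) ≤ wordLen (genSet r) g :=
  (exists_short_representative r g).choose_spec.2

lemma shortRep_one : shortRep r 1 = 1 := by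
  have h := norm_shortRep_le r 1
  rw [wordLen_one, Nat.le_zero] at h
  exact FreeGroup.norm_eq_zero.1 h

/-- The area needed to replace a word by the chosen short representative. -/
noncomputable def repArea (x : FreeGroup (Fin d)) : ℕ := fillingArea r (x * (shortRep r x)⁻¹)

variable {r}

lemma mul_shortRep_inv_mem (x : FreeGroup (Fin d)) : x * (shortRep r x)⁻¹ ∈ relSubgroup r := by
  rw [← QuotientGroup.eq_one_iff]
  simp

lemma repArea_of_mem {x : FreeGroup (Fin d)} (hx : x ∈ relSubgroup r) :
    repArea r x = fillingArea r x := by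
  rw [repArea, (QuotientGroup.eq_one_iff x).2 hx, shortRep_one, inv_one, mul_one]

lemma repArea_mul_le (x y : FreeGroup (Fin d)) :
    repArea r (x * y) ≤ repArea r x + repArea r y +
      dehn r (2 * (wordLen (genSet r) (x : FreeGroup (Fin d) ⧸ relSubgroup r) +
        wordLen (genSet r) (y : FreeGroup (Fin d) ⧸ relSubgroup r))) := by
  set γx := shortRep r x with hγx
  set γy := shortRep r y with hγy
  set γxy := shortRep r ((x * y : FreeGroup (Fin d)) : FreeGroup (Fin d) ⧸ relSubgroup r) with hγxy
  have hz : γx * γy * γxy⁻¹ ∈ relSubgroup r := by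
    rw [← QuotientGroup.eq_one_iff]
    simp [hγx, hγy, hγxy]
  have hy : γx * (y * γy⁻¹) * γx⁻¹ ∈ relSubgroup r :=
    Subgroup.Normal.conj_mem inferInstance _ (mul_shortRep_inv_mem y) _
  have hx := mul_shortRep_inv_mem (r := r) x
  have heq : x * y * γxy⁻¹ = x * γx⁻¹ * (γx * (y * γy⁻¹) * γx⁻¹) * (γx * γy * γxy⁻¹) := by group
  rw [repArea, ← hγxy, heq]
  refine (fillingArea_mul_le (mul_mem hx hy) hz).trans (add_le_add
    ((fillingArea_mul_le hx hy).trans (add_le_add le_rfl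
      (fillingArea_conj_le (mul_shortRep_inv_mem y) _))) (fillingArea_le_dehn hz ?_))
  have h1 := FreeGroup.norm_mul_le (γx * γy) γxy⁻¹
  have h2 := FreeGroup.norm_mul_le γx γy
  have h3 : γx.norm ≤ _ := norm_shortRep_le r (x : FreeGroup (Fin d) ⧸ relSubgroup r)
  have h4 : γy.norm ≤ _ := norm_shortRep_le r (y : FreeGroup (Fin d) ⧸ relSubgroup r)
  have h5 : γxy.norm ≤ _ :=
    norm_shortRep_le r ((x * y : FreeGroup (Fin d)) : FreeGroup (Fin d) ⧸ relSubgroup r)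
  have h6 := wordLen_mul_le (genSet_inv r) (closure_genSet r)
    (x : FreeGroup (Fin d) ⧸ relSubgroup r) (y : FreeGroup (Fin d) ⧸ relSubgroup r)
  rw [FreeGroup.norm_inv_eq] at h1
  rw [QuotientGroup.mk_mul] at h5
  omega

end Quotient

section AverageArea
variable {r : Fin s → FreeGroup (Fin d)} [DecidableEq (FreeGroup (Fin d) ⧸ relSubgroup r)]

lemma exists_repArea_mul_le {k : ℝ} (hk : 0 ≤ k) (hdehn : ∃ C : ℝ, ∃ N₀ : ℕ, ∀ n : ℕ, N₀ ≤ n →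
    (dehn r n : ℝ) ≤ C * (n : ℝ) ^ k) :
    ∃ C : ℝ, 0 ≤ C ∧ ∀ x y : FreeGroup (Fin d), (repArea r (x * y) : ℝ) ≤
      repArea r x + repArea r y +
        C * (1 + (wordLen (genSet r) (x : FreeGroup (Fin d) ⧸ relSubgroup r) : ℝ) ^ k +
          (wordLen (genSet r) (y : FreeGroup (Fin d) ⧸ relSubgroup r) : ℝ) ^ k) := by
  obtain ⟨C, hC0, hC⟩ := exists_dehn_le hk hdehn
  refine ⟨C * 5 ^ k, by positivity, fun x y => ?_⟩
  have h := repArea_mul_le (r := r) x y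
  set L₁ := wordLen (genSet r) (x : FreeGroup (Fin d) ⧸ relSubgroup r)
  set L₂ := wordLen (genSet r) (y : FreeGroup (Fin d) ⧸ relSubgroup r)
  have h' : (repArea r (x * y) : ℝ) ≤ repArea r x + repArea r y + dehn r (2 * (L₁ + L₂)) := by
    exact_mod_cast h
  refine h'.trans (add_le_add le_rfl ((hC _).trans ?_))
  rw [mul_assoc]
  refine mul_le_mul_of_nonneg_left ?_ hC0
  have hbd : ∀ M : ℝ, 1 ≤ M → (L₁ : ℝ) ≤ M → (L₂ : ℝ) ≤ M →
      (1 + ((2 * (L₁ + L₂) : ℕ) : ℝ)) ^ k ≤ 5 ^ k * M ^ k := by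
    intro M h1 h2 h3
    rw [← Real.mul_rpow (by norm_num) (by linarith)]
    refine Real.rpow_le_rpow (by positivity) ?_ hk
    push_cast
    linarith
  have p1 : (0 : ℝ) ≤ (L₁ : ℝ) ^ k := by positivity
  have p2 : (0 : ℝ) ≤ (L₂ : ℝ) ^ k := by positivity
  have p5 : (0 : ℝ) ≤ 5 ^ k := by positivity
  by_cases h1 : (L₁ : ℝ) ≤ 1 ∧ (L₂ : ℝ) ≤ 1
  · refine (hbd 1 le_rfl h1.1 h1.2).trans (mul_le_mul_of_nonneg_left ?_ p5)
    rw [Real.one_rpow]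
    linarith
  · rcases le_total (L₁ : ℝ) L₂ with h | h
    · refine (hbd L₂ ?_ h le_rfl).trans (mul_le_mul_of_nonneg_left (by linarith) p5)
      by_contra! h2
      exact h1 ⟨by linarith, by linarith⟩
    · refine (hbd L₁ ?_ le_rfl h).trans (mul_le_mul_of_nonneg_left (by linarith) p5)
      by_contra! h2
      exact h1 ⟨by linarith, by linarith⟩

variable (r) in
lemma exists_repArea_le_of_length_le_one :
    ∃ B : ℝ, 0 ≤ B ∧ ∀ l : List (Letter d), l.length ≤ 1 →
      (repArea r (l.map letterVal).prod : ℝ) ≤ B := by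
  refine ⟨repArea r 1 + ∑ ℓ : Letter d, (repArea r (letterVal ℓ) : ℝ), by positivity,
    fun l hl => ?_⟩
  rcases l with _ | ⟨ℓ, _ | ⟨_, _⟩⟩
  · simp only [List.map_nil, List.prod_nil]
    exact le_add_of_nonneg_right (by positivity)
  · simp only [List.map_cons, List.map_nil, List.prod_cons, List.prod_nil, mul_one]
    exact (Finset.single_le_sum (f := fun ℓ : Letter d => (repArea r (letterVal ℓ) : ℝ))
      (fun _ _ => by positivity) (Finset.mem_univ ℓ)).trans (le_add_of_nonneg_left (by positivity))
  · simp at hl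

/-- The expected area of the window of length at most `2 ^ j` of a closed word. -/
lemma exists_wordSum_repArea_le {κ : ℕ}
    (hκ : ∀ n, (genSet r ^ (2 * n)).card ≤ κ * (genSet r ^ n).card) {k : ℝ} (hk : 2 < k)
    (hdehn : ∃ C : ℝ, ∃ N₀ : ℕ, ∀ n : ℕ, N₀ ≤ n → (dehn r n : ℝ) ≤ C * (n : ℝ) ^ k) :
    ∃ D : ℝ, 0 ≤ D ∧ ∀ n j a m : ℕ, 8 ≤ n → a + m ≤ n → m ≤ 2 ^ j →
      wordSum n (fun l => (Pi.single 1 1 : FreeGroup (Fin d) ⧸ relSubgroup r → ℝ)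
        (l.map (letterQuot r)).prod * (repArea r (((l.drop a).take m).map letterVal).prod : ℝ)) ≤
      D * ((2 : ℝ) ^ (k / 2)) ^ j *
        wordSum n (fun l => (Pi.single 1 1 : FreeGroup (Fin d) ⧸ relSubgroup r → ℝ)
          (l.map (letterQuot r)).prod) := by
  have hk0 : 0 ≤ k := by linarith
  obtain ⟨C₁, hC₁, hmul⟩ := exists_repArea_mul_le (r := r) hk0 hdehn
  obtain ⟨B, hB0, hB⟩ := exists_repArea_le_of_length_le_one r
  obtain ⟨C, hC0, hC⟩ := exists_wordSum_closed_rpow_le (letterQuot_letterInv r) (letterQuot_none r)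
    (one_mem_genSet r) (genSet_inv r) (closure_genSet r) (letterQuot_mem_genSet r)
    (exists_letterQuot_eq r) hκ hk0
  set θ : ℝ := 2 ^ (k / 2) with hθ
  have hθ2 : 2 < θ := by
    conv_lhs => rw [← Real.rpow_one 2]
    exact Real.rpow_lt_rpow_of_exponent_lt (by norm_num) (by linarith)
  have hθ0 : 0 < θ - 2 := by linarith
  have hθ1 : 0 < θ := by linarith
  set D := B + C₁ * (1 + 2 * C * θ) / (θ - 2) with hD
  have hD0 : 0 ≤ D := by positivity
  have hDB : B ≤ D := le_add_of_nonneg_right (by positivity)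
  have hDθ : C₁ * (1 + 2 * C * θ) ≤ D * (θ - 2) := by
    rw [hD, add_mul, div_mul_cancel₀ _ hθ0.ne']
    exact le_add_of_nonneg_left (by positivity)
  refine ⟨D, hD0, fun n j a m hn => ?_⟩
  have hδ : ∀ x : FreeGroup (Fin d) ⧸ relSubgroup r,
      0 ≤ (Pi.single 1 1 : FreeGroup (Fin d) ⧸ relSubgroup r → ℝ) x :=
    fun x => heat_nonneg (σ := letterQuot r) 0 x
  have hZ : 0 ≤ wordSum n (fun l => (Pi.single 1 1 : FreeGroup (Fin d) ⧸ relSubgroup r → ℝ)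
      (l.map (letterQuot r)).prod) := by
    rw [wordSum_eq_sum]
    exact Finset.sum_nonneg fun _ _ => hδ _
  set Z := wordSum n (fun l => (Pi.single 1 1 : FreeGroup (Fin d) ⧸ relSubgroup r → ℝ)
    (l.map (letterQuot r)).prod) with hZdef
  induction j generalizing a m with
  | zero =>
    intro ham hm
    rw [pow_zero, mul_one, ← wordSum_const_mul]
    refine wordSum_mono fun l hl => ?_
    rw [mul_comm]
    refine mul_le_mul_of_nonneg_right ((hB _ ?_).trans hDB) (hδ _)
    simp only [pow_zero] at hm
    simp only [List.length_take]
    omega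
  | succ j ih =>
    intro ham hm
    rw [pow_succ] at hm
    have h1 := ih a (m / 2) (by omega) (by omega)
    have h2 := ih (a + m / 2) (m - m / 2) (by omega) (by omega)
    have hR1 : 1 ≤ 2 ^ ((j + 1) / 2) := Nat.one_le_two_pow
    have hR2 : 2 ^ j ≤ (2 ^ ((j + 1) / 2)) ^ 2 := by
      rw [← pow_mul]
      exact Nat.pow_le_pow_right (by norm_num) (by omega)
    have hRk : (((2 ^ ((j + 1) / 2) : ℕ) : ℝ)) ^ k ≤ θ ^ (j + 1) := by
      push_cast
      rw [hθ, ← Real.rpow_natCast, ← Real.rpow_natCast, ← Real.rpow_mul (by norm_num),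
        ← Real.rpow_mul (by norm_num)]
      refine Real.rpow_le_rpow_of_exponent_le (by norm_num) ?_
      have : (((j + 1) / 2 : ℕ) : ℝ) ≤ ((j + 1 : ℕ) : ℝ) / 2 := Nat.cast_div_le
      nlinarith
    have h3 := hC n a (m / 2) _ hn (by omega) hR1 (by omega)
    have h4 := hC n (a + m / 2) (m - m / 2) _ hn (by omega) hR1 (by omega)
    rw [← hZdef] at h3 h4
    have h5 : ∀ l : List (Letter d),
        (Pi.single 1 1 : FreeGroup (Fin d) ⧸ relSubgroup r → ℝ) (l.map (letterQuot r)).prod *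
          (repArea r (((l.drop a).take m).map letterVal).prod : ℝ) ≤
        ((Pi.single 1 1 : FreeGroup (Fin d) ⧸ relSubgroup r → ℝ) (l.map (letterQuot r)).prod *
            (repArea r (((l.drop a).take (m / 2)).map letterVal).prod : ℝ) +
          (Pi.single 1 1 : FreeGroup (Fin d) ⧸ relSubgroup r → ℝ) (l.map (letterQuot r)).prod *
            (repArea r (((l.drop (a + m / 2)).take (m - m / 2)).map letterVal).prod : ℝ)) +
        C₁ * (((Pi.single 1 1 : FreeGroup (Fin d) ⧸ relSubgroup r → ℝ)
            (l.map (letterQuot r)).prod +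
          (Pi.single 1 1 : FreeGroup (Fin d) ⧸ relSubgroup r → ℝ) (l.map (letterQuot r)).prod *
            (wordLen (genSet r) (((l.drop a).take (m / 2)).map (letterQuot r)).prod : ℝ) ^ k) +
          (Pi.single 1 1 : FreeGroup (Fin d) ⧸ relSubgroup r → ℝ) (l.map (letterQuot r)).prod *
            (wordLen (genSet r)
              (((l.drop (a + m / 2)).take (m - m / 2)).map (letterQuot r)).prod : ℝ) ^ k) := by
      intro l
      have e1 : (l.drop a).take m = (l.drop a).take (m / 2) ++
          (l.drop (a + m / 2)).take (m - m / 2) := by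
        conv_lhs => rw [show m = m / 2 + (m - m / 2) by omega]
        rw [List.take_add, List.drop_drop]
      rw [e1, List.map_append, List.prod_append, prod_map_letterQuot r ((l.drop a).take (m / 2)),
        prod_map_letterQuot r ((l.drop (a + m / 2)).take (m - m / 2))]
      refine (mul_le_mul_of_nonneg_left (hmul _ _) (hδ _)).trans_eq ?_
      ring
    refine (wordSum_mono fun l _ => h5 l).trans ?_
    rw [wordSum_add, wordSum_add, wordSum_const_mul, wordSum_add, wordSum_add, ← hZdef]
    have hone : 1 ≤ θ ^ j := one_le_pow₀ (by linarith)
    calc _ ≤ (D * θ ^ j * Z + D * θ ^ j * Z) +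
          C₁ * (Z + C * θ ^ (j + 1) * Z + C * θ ^ (j + 1) * Z) := by
          gcongr
          · exact h3.trans (by gcongr)
          · exact h4.trans (by gcongr)
      _ ≤ (D * θ ^ j * Z + D * θ ^ j * Z) +
          C₁ * (θ ^ j * Z + C * θ ^ (j + 1) * Z + C * θ ^ (j + 1) * Z) := by
          gcongr
          exact le_mul_of_one_le_left hZ hone
      _ = 2 * D * (θ ^ j * Z) + C₁ * (1 + 2 * C * θ) * (θ ^ j * Z) := by ring
      _ ≤ 2 * D * (θ ^ j * Z) + D * (θ - 2) * (θ ^ j * Z) := by gcongr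
      _ = D * θ ^ (j + 1) * Z := by ring

lemma single_prod_letterQuot_ofFn {n : ℕ} (w : Fin n → Letter d) :
    (Pi.single 1 1 : FreeGroup (Fin d) ⧸ relSubgroup r → ℝ)
      ((List.ofFn w).map (letterQuot r)).prod =
    open scoped Classical in if partialProd w n ∈ relSubgroup r then 1 else 0 := by
  have h : partialProd w n = ((List.ofFn w).map letterVal).prod := by
    rw [partialProd, List.take_of_length_le (by simp)]
  rw [prod_map_letterQuot, Pi.single_apply, h]
  by_cases hw : ((List.ofFn w).map letterVal).prod ∈ relSubgroup r
  · rw [if_pos hw, if_pos ((QuotientGroup.eq_one_iff _).2 hw)]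
  · rw [if_neg hw, if_neg (mt (QuotientGroup.eq_one_iff _).1 hw)]

lemma wordSum_single_eq_card (n : ℕ) :
    wordSum n (fun l => (Pi.single 1 1 : FreeGroup (Fin d) ⧸ relSubgroup r → ℝ)
      (l.map (letterQuot r)).prod) = (closedWords r n).card := by
  simp only [wordSum_eq_sum, single_prod_letterQuot_ofFn, closedWords, Finset.sum_boole]

lemma wordSum_single_mul_repArea (n : ℕ) :
    wordSum n (fun l => (Pi.single 1 1 : FreeGroup (Fin d) ⧸ relSubgroup r → ℝ)
      (l.map (letterQuot r)).prod * (repArea r (((l.drop 0).take n).map letterVal).prod : ℝ)) =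
    ∑ w ∈ closedWords r n, (fillingArea r (partialProd w n) : ℝ) := by
  classical
  rw [wordSum_eq_sum, closedWords, Finset.sum_filter]
  refine Finset.sum_congr rfl fun w _ => ?_
  rw [single_prod_letterQuot_ofFn, List.drop_zero]
  split_ifs with h
  · rw [one_mul, ← repArea_of_mem h, partialProd]
  · rw [zero_mul]

end AverageArea

end Auxiliary

theorem avgDehn_bigO_of_dehn_bigO {d s : ℕ} (r : Fin s → FreeGroup (Fin d))
    (hnilp : Group.IsNilpotent (FreeGroup (Fin d) ⧸ relSubgroup r))
    (k : ℝ) (hk : 2 < k)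
    (hdehn : ∃ C : ℝ, ∃ N₀ : ℕ, ∀ n : ℕ, N₀ ≤ n → (dehn r n : ℝ) ≤ C * (n : ℝ) ^ k) :
    ∃ C' : ℝ, ∃ N₁ : ℕ, ∀ n : ℕ, N₁ ≤ n → avgDehn r n ≤ C' * (n : ℝ) ^ (k / 2) := by
  classical
  obtain ⟨c, hc⟩ := Subgroup.nilpotent_iff_lowerCentralSeries.1 hnilp
  obtain ⟨κ, hκ⟩ := exists_card_pow_two_mul_le_of_lcs c _ (genSet r) (one_mem_genSet r)
    (genSet_inv r) (closure_genSet r) hc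
  obtain ⟨D, hD0, hD⟩ := exists_wordSum_repArea_le hκ hk hdehn
  refine ⟨D * 2 ^ (k / 2), 8, fun n hn => ?_⟩
  have h := hD n (Nat.clog 2 n) 0 n hn (by omega) (Nat.le_pow_clog (by norm_num) n)
  rw [wordSum_single_mul_repArea, wordSum_single_eq_card] at h
  rw [avgDehn]
  refine div_le_of_le_mul₀ (by positivity) (by positivity) (h.trans ?_)
  refine mul_le_mul_of_nonneg_right ?_ (by positivity)
  rw [mul_assoc]
  refine mul_le_mul_of_nonneg_left ?_ hD0
  have hlt : 2 ^ (Nat.clog 2 n).pred < n := Nat.pow_pred_clog_lt_self (by norm_num) (by omega)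
  have hpos : 0 < Nat.clog 2 n := Nat.clog_pos (by norm_num) (by omega)
  have hle : (2 : ℝ) ^ Nat.clog 2 n ≤ 2 * n := by
    have : 2 ^ Nat.clog 2 n = 2 ^ (Nat.clog 2 n).pred * 2 := by
      rw [← pow_succ, ← Nat.succ_eq_add_one, Nat.succ_pred_eq_of_pos hpos]
    have h2 : 2 ^ Nat.clog 2 n ≤ 2 * n := by omega
    exact_mod_cast h2
  rw [← Real.mul_rpow (by norm_num) (by positivity), ← Real.rpow_natCast, ← Real.rpow_mul (by norm_num),
    mul_comm (k / 2), Real.rpow_mul (by norm_num), Real.rpow_natCast]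
  exact Real.rpow_le_rpow (by positivity) hle (by linarith)

end AvgDehnPaper
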